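/- arXiv:2003.03639 — 2 statements merged into one kernel-verified Lean document; each statement's English description precedes it below -/
import Mathlib

section
/- Let k ≥ 2 and let F, F' be minimally unsatisfiable 2-clause-sets of deficiency k. Then a bijection f from the literals over the variables of F to the literals over the variables of F' is an isomorphism of clause-sets from F to F' if and only if f is an isomorphism of digraphs from idg(F) to idg(F'). In other words, the set of clause-set isomorphisms F → F' (as maps on literals) is exactly equal to the set of digraph isomorphisms idg(F) → idg(F'). -/
/-- A literal: a variable (a natural number) together with a polarity. -/
abbrev Lit : Type := ℕ × Bool

/-- Complementation of literals: a fixed-point-free involution. -/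
def Lit.compl (x : Lit) : Lit := (x.1, !x.2)

/-- The set of variables occurring in a clause-set. -/
def varsOf (F : Finset (Finset Lit)) : Finset ℕ := F.biUnion (fun C => C.image Prod.fst)

/-- The literals over the variables of `F` (both polarities). -/
def litsOf (F : Finset (Finset Lit)) : Finset Lit := varsOf F ×ˢ (Finset.univ : Finset Bool)

/-- A clause is clash-free. -/
def IsClause (C : Finset Lit) : Prop := ∀ x ∈ C, Lit.compl x ∉ C

/-- A clause-set consists of clauses. -/
def IsClauseSet (F : Finset (Finset Lit)) : Prop := ∀ C ∈ F, IsClause C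

/-- The truth value of a literal under a total assignment. -/
def LitVal (φ : ℕ → Bool) (x : Lit) : Bool := if x.2 then φ x.1 else !(φ x.1)

/-- Satisfiability of a clause-set. -/
def Sat (F : Finset (Finset Lit)) : Prop := ∃ φ : ℕ → Bool, ∀ C ∈ F, ∃ x ∈ C, LitVal φ x = true

/-- Minimal unsatisfiability. -/
def MU (F : Finset (Finset Lit)) : Prop := IsClauseSet F ∧ ¬ Sat F ∧ ∀ G ⊂ F, Sat G

/-- Minimally unsatisfiable 2-clause-set. -/
def MU2 (F : Finset (Finset Lit)) : Prop := MU F ∧ ∀ C ∈ F, C.card ≤ 2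

/-- The deficiency δ(F) = c(F) - n(F). -/
def deficiency (F : Finset (Finset Lit)) : ℤ := (F.card : ℤ) - ((varsOf F).card : ℤ)

/-- Literal-degree: number of clauses containing the literal. -/
def ldeg (F : Finset (Finset Lit)) (x : Lit) : ℕ := (F.filter (fun C => x ∈ C)).card

/-- Variable-degree. -/
def vdeg (F : Finset (Finset Lit)) (v : ℕ) : ℕ := ldeg F (v, true) + ldeg F (v, false)

/-- Isomorphism of clause-sets: a bijection between the literals over the variables,
commuting with complementation, mapping one clause-set onto the other. -/
def CNFIso (F F' : Finset (Finset Lit)) (f : Lit → Lit) : Prop :=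
  Set.BijOn f ↑(litsOf F) ↑(litsOf F') ∧
  (∀ x ∈ litsOf F, f (Lit.compl x) = Lit.compl (f x)) ∧
  F.image (fun C => C.image f) = F'

/-- A digraph: a finite vertex set and a finite set of arcs. -/
structure FinDigraph (α : Type) where
  V : Finset α
  E : Finset (α × α)

/-- Well-formedness of a digraph: arcs join distinct vertices. -/
def FinDigraph.WellFormed {α : Type} (G : FinDigraph α) : Prop :=
  ∀ p ∈ G.E, p.1 ∈ G.V ∧ p.2 ∈ G.V ∧ p.1 ≠ p.2

/-- `f` is an isomorphism of digraphs from `G` to `G'`. -/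
def DigraphIso {α β : Type} [DecidableEq β] (G : FinDigraph α) (G' : FinDigraph β) (f : α → β) : Prop :=
  Set.BijOn f ↑G.V ↑G'.V ∧ G.E.image (fun p => (f p.1, f p.2)) = G'.E

/-- The implication digraph of a 2-clause-set (without the empty clause):
vertices are the literals over the variables of `F`, and there is an arc `(a,b)` iff
`{compl a} ∪ {b}` is a clause of `F` (this yields `(x̄,y),(ȳ,x)` for a clause `{x,y}`
and `(x̄,x)` for a unit-clause `{x}`). -/
def idg (F : Finset (Finset Lit)) : FinDigraph Lit :=
  ⟨litsOf F, (litsOf F ×ˢ litsOf F).filter (fun p => insert (Lit.compl p.1) {p.2} ∈ F)⟩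

def FinDigraph.inDeg {α : Type} [DecidableEq α] (G : FinDigraph α) (v : α) : ℕ :=
  (G.E.filter (fun p => p.2 = v)).card

def FinDigraph.outDeg {α : Type} [DecidableEq α] (G : FinDigraph α) (v : α) : ℕ :=
  (G.E.filter (fun p => p.1 = v)).card

/-- The standard double `m`-cycle. -/
def stdDoubleCycle (m : ℕ) : FinDigraph ℕ :=
  ⟨Finset.range m, (Finset.range m).biUnion (fun i => {(i, (i+1) % m), ((i+1) % m, i)})⟩

/-- A double `m`-cycle (`m ≥ 3`). -/
def IsDoubleCycle {α : Type} [DecidableEq α] (m : ℕ) (G : FinDigraph α) : Prop :=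
  3 ≤ m ∧ ∃ f : ℕ → α, DigraphIso (stdDoubleCycle m) G f

/-- Splitting a vertex `x` into `u`, `v` with a new arc `(u,v)`:
arcs into `x` now go into `u`, arcs out of `x` now leave `v`. -/
def SplitVertex {α : Type} [DecidableEq α] (G G' : FinDigraph α) : Prop :=
  ∃ x u v, x ∈ G.V ∧ u ∉ G.V ∧ v ∉ G.V ∧ u ≠ v ∧
    G'.V = insert u (insert v (G.V.erase x)) ∧
    G'.E = insert (u, v)
      ((G.E.filter (fun p => p.1 ≠ x ∧ p.2 ≠ x)) ∪
       ((G.E.filter (fun p => p.2 = x)).image (fun p => (p.1, u))) ∪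
       ((G.E.filter (fun p => p.1 = x)).image (fun p => (v, p.2))))

/-- Splitting an arc `(x,y)` by a new (linear) vertex `v`. -/
def SplitArc {α : Type} [DecidableEq α] (G G' : FinDigraph α) : Prop :=
  ∃ x y v, (x, y) ∈ G.E ∧ v ∉ G.V ∧
    G'.V = insert v G.V ∧
    G'.E = insert (x, v) (insert (v, y) (G.E.erase (x, y)))

/-- An `m`-weak-double-cycle: obtained from a double `m`-cycle by a finite sequence
of vertex splittings and arc splittings. -/
def IsWDC {α : Type} [DecidableEq α] (m : ℕ) (G : FinDigraph α) : Prop :=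
  ∃ G₀ : FinDigraph α, IsDoubleCycle m G₀ ∧
    Relation.ReflTransGen (fun A B => SplitVertex A B ∨ SplitArc A B) G₀ G

/-- A digraph is nonlinear if no vertex has in-degree 1 and out-degree 1. -/
def FinDigraph.Nonlinear {α : Type} [DecidableEq α] (G : FinDigraph α) : Prop :=
  ∀ v ∈ G.V, ¬ (G.inDeg v = 1 ∧ G.outDeg v = 1)

/-- Strong connectivity. -/
def StronglyConnected {α : Type} (G : FinDigraph α) : Prop :=
  ∀ a ∈ G.V, ∀ b ∈ G.V, Relation.ReflTransGen (fun x y => (x, y) ∈ G.E) a b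

/-- A cycle digraph: strongly connected, at least 2 vertices, all vertices linear. -/
def IsCycleDigraph {α : Type} [DecidableEq α] (G : FinDigraph α) : Prop :=
  G.WellFormed ∧ 2 ≤ G.V.card ∧ StronglyConnected G ∧
    ∀ v ∈ G.V, G.inDeg v = 1 ∧ G.outDeg v = 1

/-- A skew-symmetry of a digraph, as a permutation of its vertex set:
a fixed-point-free involution reversing arcs. -/
def IsSkewSym {α : Type} (G : FinDigraph α) (σ : Equiv.Perm {x // x ∈ G.V}) : Prop :=
  (∀ v, σ (σ v) = v) ∧ (∀ v, σ v ≠ v) ∧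
  ∀ a b : {x // x ∈ G.V}, ((a : α), (b : α)) ∈ G.E → (((σ b : α)), ((σ a : α))) ∈ G.E

/-- A skew-symmetry has a unit if some vertex is joined by an arc to its image. -/
def HasUnit {α : Type} (G : FinDigraph α) (σ : Equiv.Perm {x // x ∈ G.V}) : Prop :=
  ∃ v : {x // x ∈ G.V}, ((v : α), ((σ v : α))) ∈ G.E

/-- The literals over the variables of `F` are closed under complementation. -/
lemma compl_mem {F : Finset (Finset Lit)} {x : Lit} (h : x ∈ litsOf F) :
    Lit.compl x ∈ litsOf F := by
  simp only [litsOf, Lit.compl, Finset.mem_product] at h ⊢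
  exact ⟨h.1, Finset.mem_univ _⟩

/-- Clause-set isomorphism, as an equivalence between the literals over the variables. -/
def CNFIsoE (F F' : Finset (Finset Lit))
    (e : {x // x ∈ litsOf F} ≃ {x // x ∈ litsOf F'}) : Prop :=
  (∀ x : {x // x ∈ litsOf F}, (e ⟨Lit.compl x.1, compl_mem x.2⟩ : Lit) = Lit.compl (e x : Lit)) ∧
  F.image (fun C => C.image (fun y =>
      if h : y ∈ litsOf F then ((e ⟨y, h⟩ : {x // x ∈ litsOf F'}) : Lit) else y)) = F'

/-- An automorphism of a digraph, as a permutation of its vertex set preserving arcs. -/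
def FinDigraphAut {α : Type} (G : FinDigraph α) (π : Equiv.Perm {x // x ∈ G.V}) : Prop :=
  ∀ a b : {x // x ∈ G.V}, ((a : α), (b : α)) ∈ G.E ↔ ((π a : α), (π b : α)) ∈ G.E

/-- Multiplicity of the edge between `u` and `v` in the underlying multigraph of a digraph. -/
def mult {α : Type} [DecidableEq α] (G : FinDigraph α) (u v : α) : ℕ :=
  (if (u, v) ∈ G.E then 1 else 0) + (if (v, u) ∈ G.E then 1 else 0)

/-- `f` is an isomorphism between the underlying multigraphs of two digraphs. -/
def MultigraphIso {α β : Type} [DecidableEq α] [DecidableEq β]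
    (G : FinDigraph α) (G' : FinDigraph β) (f : α → β) : Prop :=
  Set.BijOn f ↑G.V ↑G'.V ∧ ∀ u ∈ G.V, ∀ v ∈ G.V, mult G u v = mult G' (f u) (f v)

/-- `f` is an isomorphism between the underlying graphs of two digraphs. -/
def GraphIso {α β : Type} (G : FinDigraph α) (G' : FinDigraph β) (f : α → β) : Prop :=
  Set.BijOn f ↑G.V ↑G'.V ∧ ∀ u ∈ G.V, ∀ v ∈ G.V,
    (((u, v) ∈ G.E ∨ (v, u) ∈ G.E) ↔ ((f u, f v) ∈ G'.E ∨ (f v, f u) ∈ G'.E))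

/-- The transpose of a digraph: all arcs reversed. -/
def FinDigraph.transpose {α : Type} [DecidableEq α] (G : FinDigraph α) : FinDigraph α :=
  ⟨G.V, G.E.image (fun p => (p.2, p.1))⟩

/-- DP-reduction on variable `v`: replace all clauses containing `v` or `v̄` by all
their non-tautological resolvents on `v`. -/
def DP (v : ℕ) (F : Finset (Finset Lit)) : Finset (Finset Lit) :=
  (F.filter (fun C => (v, true) ∉ C ∧ (v, false) ∉ C)) ∪
  ((((F.filter (fun C => (v, true) ∈ C)) ×ˢ (F.filter (fun C => (v, false) ∈ C))).image
      (fun p => (p.1.erase (v, true)) ∪ (p.2.erase (v, false)))).filter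
    (fun C => ∀ x ∈ C, Lit.compl x ∉ C))

/-- A variable is singular if one of its literals has literal-degree 1. -/
def Singular (F : Finset (Finset Lit)) (v : ℕ) : Prop :=
  ldeg F (v, true) = 1 ∨ ldeg F (v, false) = 1

/-- The "middle part" `M_n = {{v̄_1,v_2},…,{v̄_{n−1},v_n}}`, with variables `1,…,n`. -/
def Mn (n : ℕ) : Finset (Finset Lit) :=
  (Finset.Icc 1 (n - 1)).image (fun i => ({(i, false), (i + 1, true)} : Finset Lit))

def famU2 (n : ℕ) : Finset (Finset Lit) :=
  Mn n ∪ {({((1 : ℕ), true)} : Finset Lit), ({((n : ℕ), false)} : Finset Lit)}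

def famU1 (n i : ℕ) : Finset (Finset Lit) :=
  Mn n ∪ {({((1 : ℕ), true)} : Finset Lit), ({((n : ℕ), false), ((i : ℕ), false)} : Finset Lit)}

def famU0s (n i : ℕ) : Finset (Finset Lit) :=
  Mn n ∪ {({((1 : ℕ), true), ((i : ℕ), true)} : Finset Lit),
          ({((n : ℕ), false), ((i : ℕ), false)} : Finset Lit)}

def famU0 (n x y : ℕ) : Finset (Finset Lit) :=
  Mn n ∪ {({((1 : ℕ), true), ((x : ℕ), true)} : Finset Lit),
          ({((n : ℕ), false), ((y : ℕ), false)} : Finset Lit)}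

/-- Membership in one of the four families (with the stated parameter ranges). -/
def InFam (G : Finset (Finset Lit)) : Prop :=
  (∃ n, 1 ≤ n ∧ G = famU2 n) ∨
  (∃ n i, 2 ≤ n ∧ 1 ≤ i ∧ i ≤ n - 1 ∧ G = famU1 n i) ∨
  (∃ n i, 3 ≤ n ∧ 2 ≤ i ∧ 2 * i ≤ n + 1 ∧ G = famU0s n i) ∨
  (∃ n x y, 4 ≤ n ∧ 2 ≤ x ∧ x < y ∧ y ≤ n - 1 ∧ x + y ≤ n + 1 ∧ G = famU0 n x y)

/-- The number of unit-clauses of `F`. -/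
def unitCount (F : Finset (Finset Lit)) : ℕ := (F.filter (fun C => C.card = 1)).card

/-- MU 2-clause-sets of deficiency `k` with exactly `n` variables. -/
def MU2dn (k : ℤ) (n : ℕ) : Type :=
  {F : Finset (Finset Lit) // MU2 F ∧ deficiency F = k ∧ (varsOf F).card = n}

/-- Isomorphism relation on `MU2dn k n`. -/
def isoRel {k : ℤ} {n : ℕ} (F F' : MU2dn k n) : Prop := ∃ f, CNFIso F.1 F'.1 f

/-- The number of isomorphism classes of MU 2-clause-sets of deficiency `k`
with exactly `n` variables. -/
noncomputable def numClasses (k : ℤ) (n : ℕ) : ℕ := Nat.card (Quot (@isoRel k n))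

/-- Equivalence of binary bracelets of length `m`: rotations and reflections of the
cyclic index set. -/
def BraceletRel (m : ℕ) (b b' : ZMod m → Bool) : Prop :=
  ∃ (r : ZMod m) (s : Bool), ∀ i, b' i = b (if s then r - i else i + r)

/-- Digraph-isomorphism relation on nonlinear `m`-WDCs. -/
def NonlinWDCRel (m : ℕ) (G G' : {G : FinDigraph ℕ // IsWDC m G ∧ G.Nonlinear}) : Prop :=
  ∃ f : ℕ → ℕ, DigraphIso G.1 G'.1 f

/-- `H` is a subdigraph of `G`. -/
def Subdigraph {α : Type} (H G : FinDigraph α) : Prop := H.V ⊆ G.V ∧ H.E ⊆ G.E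

section SkewSymmetric

open Relation

variable {V : Type*} {R : V → V → Prop} {σ τ : V → V}

/-- `σ` is a fixed-point-free involution reversing the arcs of `R`. -/
structure SkewInvolution (R : V → V → Prop) (σ : V → V) : Prop where
  invol : ∀ x, σ (σ x) = x
  ne : ∀ x, σ x ≠ x
  rev : ∀ a b, R a b → R (σ b) (σ a)

/-- Close a relation under the arc reversal given by `σ`. -/
def skewClosure (σ : V → V) (E : V → V → Prop) (a b : V) : Prop := E a b ∨ E (σ b) (σ a)

/-- Some vertex and its `σ`-partner reach each other. -/
def Contradictory (H : V → V → Prop) (σ : V → V) : Prop :=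
  ∃ x, ReflTransGen H x (σ x) ∧ ReflTransGen H (σ x) x

/-- Every contradictory `σ`-closed subrelation of `R` is all of `R`. -/
def Critical (R : V → V → Prop) (σ : V → V) : Prop :=
  ∀ E : V → V → Prop, (∀ a b, E a b → R a b) → Contradictory (skewClosure σ E) σ →
    ∀ a b, R a b → skewClosure σ E a b

/-- `w` winds around a simple directed cycle of length `N`. -/
structure WindsCycle (R : V → V → Prop) (w : ℤ → V) (N : ℤ) : Prop where
  pos : 0 < N
  inj : ∀ i j, w i = w j ↔ N ∣ i - j
  arc : ∀ i, R (w i) (w (i + 1))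

lemma reach_of_arcs {H : V → V → Prop} {w : ℤ → V} {m n : ℤ} (hmn : m ≤ n)
    (h : ∀ i, m ≤ i → i < n → H (w i) (w (i + 1))) : ReflTransGen H (w m) (w n) := by
  induction n, hmn using Int.leInduction with
  | base => exact .refl
  | succ k hk ih =>
    exact (ih fun i h1 h2 => h i h1 (by omega)).tail (h k hk (by omega))

lemma SkewInvolution.injective (hσ : SkewInvolution R σ) {a b : V} (h : σ a = σ b) : a = b := by
  rw [← hσ.invol a, h, hσ.invol]

lemma SkewInvolution.reach_rev (hσ : ∀ x, σ (σ x) = x) {E : V → V → Prop} {a b : V}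
    (h : ReflTransGen (skewClosure σ E) a b) :
    ReflTransGen (skewClosure σ E) (σ b) (σ a) := by
  induction h with
  | refl => exact .refl
  | tail _ hbc ih =>
    refine ReflTransGen.head ?_ ih
    rcases hbc with h | h
    · right; rwa [hσ, hσ]
    · exact .inl h

lemma skewClosure_self (hσ : SkewInvolution R σ) {a b : V} (h : skewClosure σ R a b) : R a b := by
  rcases h with h | h
  · exact h
  · simpa [hσ.invol] using hσ.rev _ _ h

lemma reach_rev_self (hσ : SkewInvolution R σ) {a b : V} (h : ReflTransGen R a b) :
    ReflTransGen R (σ b) (σ a) := by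
  have h' : ReflTransGen (skewClosure σ R) a b :=
    ReflTransGen.mono (fun _ _ h => Or.inl h) _ _ h
  exact ReflTransGen.mono (fun _ _ h => skewClosure_self hσ h) _ _
    (SkewInvolution.reach_rev hσ.invol h')

/-- `a` traverses a walk of length `n`. -/
def IsWalk (R : V → V → Prop) (a : ℤ → V) (n : ℤ) : Prop :=
  ∀ i, 0 ≤ i → i < n → R (a i) (a (i + 1))

lemma exists_walk {x y : V} (h : ReflTransGen R x y) :
    ∃ (n : ℕ) (a : ℤ → V), IsWalk R a n ∧ a 0 = x ∧ a n = y := by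
  induction h with
  | refl => exact ⟨0, fun _ => x, fun i h1 h2 => by simp at h2; omega, rfl, rfl⟩
  | @tail b c _ hbc ih =>
    obtain ⟨n, a, ha, h0, hn⟩ := ih
    refine ⟨n + 1, fun i => if i ≤ n then a i else c, fun i h1 h2 => ?_, by simp [h0], by simp⟩
    push_cast at h2
    rcases lt_or_eq_of_le (Int.lt_add_one_iff.mp h2) with h | rfl
    · simpa [h.le, Int.add_one_le_iff.mpr h] using ha i h1 h
    · simpa [hn] using hbc

lemma IsWalk.splice {a : ℤ → V} {n i j : ℤ} (ha : IsWalk R a n) (hi : 0 ≤ i) (hij : i < j)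
    (hj : j ≤ n) (h : a i = a j) :
    ∃ b, IsWalk R b (n - (j - i)) ∧ b 0 = a 0 ∧ b (n - (j - i)) = a n := by
  refine ⟨fun t => if t ≤ i then a t else a (t + (j - i)), fun t h1 h2 => ?_, by simp [hi], ?_⟩
  · rcases lt_trichotomy t i with h3 | rfl | h3
    · simpa [h3.le, Int.add_one_le_iff.mpr h3] using ha t h1 (by omega)
    · have := ha j (by omega) (by omega)
      simp only [le_refl, if_true, h, show ¬ t + 1 ≤ t by omega, if_false]
      convert this using 2; omega
    · have := ha (t + (j - i)) (by omega) (by omega)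
      simp only [show ¬ t ≤ i by omega, show ¬ t + 1 ≤ i by omega, if_false]
      convert this using 2; omega
  · by_cases h3 : n - (j - i) ≤ i
    · have : j = n := by omega
      subst this
      simp [h]
    · simp only [h3, if_false]; congr 1; omega

lemma exists_path {x y : V} (h : ReflTransGen R x y) :
    ∃ (n : ℤ) (a : ℤ → V), 0 ≤ n ∧ IsWalk R a n ∧ a 0 = x ∧ a n = y ∧
      ∀ i j, 0 ≤ i → i ≤ n → 0 ≤ j → j ≤ n → a i = a j → i = j := by
  classical
  have hex : ∃ (n : ℕ), ∃ (a : ℤ → V), IsWalk R a n ∧ a 0 = x ∧ a n = y := exists_walk h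
  obtain ⟨a, ha, h0, hn⟩ := Nat.find_spec hex
  have key : ∀ i j, 0 ≤ i → i < j → j ≤ (Nat.find hex : ℤ) → a i ≠ a j := by
    intro i j hi hij hj he
    obtain ⟨b, hb, hb0, hbn⟩ := ha.splice hi hij hj he
    have hlt : (Nat.find hex - (j - i)).toNat < Nat.find hex := by omega
    refine Nat.find_min hex hlt ⟨b, ?_, hb0.trans h0, ?_⟩
    · rwa [Int.toNat_of_nonneg (by omega)]
    · rw [Int.toNat_of_nonneg (by omega), hbn, hn]
  refine ⟨_, a, Int.natCast_nonneg _, ha, h0, hn, fun i j hi hi' hj hj' he => ?_⟩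
  rcases lt_trichotomy i j with h | h | h
  · exact absurd he (key i j hi h hj')
  · exact h
  · exact absurd he.symm (key j i hj h hi')

/-- A shortest walk from a vertex to its partner among all contradictory vertices. -/
lemma exists_clash_free_path (hσ : SkewInvolution R σ) (hU : Contradictory R σ) :
    ∃ (n : ℤ) (a : ℤ → V), 0 < n ∧ IsWalk R a n ∧ a n = σ (a 0) ∧
      ReflTransGen R (σ (a 0)) (a 0) ∧
      (∀ i j, 0 ≤ i → i ≤ n → 0 ≤ j → j ≤ n → a i = a j → i = j) ∧
      (∀ i j, 0 ≤ i → i < j → j < n → a j ≠ σ (a i)) := by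
  classical
  have hex : ∃ (n : ℕ), ∃ (a : ℤ → V), IsWalk R a n ∧ a n = σ (a 0) ∧
      ReflTransGen R (σ (a 0)) (a 0) := by
    obtain ⟨x, h1, h2⟩ := hU
    obtain ⟨n, a, ha, rfl, hn⟩ := exists_walk h1
    exact ⟨n, a, ha, hn, h2⟩
  obtain ⟨a, ha, hn, hr⟩ := Nat.find_spec hex
  have key : ∀ i j, 0 ≤ i → i < j → j ≤ (Nat.find hex : ℤ) → a i ≠ a j := by
    intro i j hi hij hj he
    obtain ⟨b, hb, hb0, hbn⟩ := ha.splice hi hij hj he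
    have hlt : (Nat.find hex - (j - i)).toNat < Nat.find hex := by omega
    refine Nat.find_min hex hlt ⟨b, ?_, ?_, by rwa [hb0]⟩
    · rwa [Int.toNat_of_nonneg (by omega)]
    · rw [Int.toNat_of_nonneg (by omega), hbn, hn, hb0]
  refine ⟨_, a, ?_, ha, hn, hr, fun i j hi hi' hj hj' he => ?_, fun i j hi hij hj he => ?_⟩
  · by_contra h0
    have : (Nat.find hex : ℤ) = 0 := by omega
    rw [this] at hn
    exact hσ.ne _ hn.symm
  · rcases lt_trichotomy i j with h | h | h
    · exact absurd he (key i j hi h hj')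
    · exact h
    · exact absurd he.symm (key j i hj h hi')
  · have hlt : (j - i).toNat < Nat.find hex := by omega
    have hreach : ReflTransGen R (a 0) (a i) :=
      reach_of_arcs hi fun t h1 h2 => ha t h1 (by omega)
    refine Nat.find_min hex hlt ⟨fun t => a (i + t), fun t h1 h2 => ?_, ?_, ?_⟩
    · have := ha (i + t) (by omega) (by omega)
      rwa [add_assoc] at this
    · simp only [add_zero]
      rw [Int.toNat_of_nonneg (by omega), ← he]; congr 1; omega
    · simp only [add_zero]
      exact ((reach_rev_self hσ hreach).trans hr).trans hreach

lemma windsCycle_of_closed_walk {g : ℤ → V} {N : ℤ} (hN : 0 < N) (hg : IsWalk R g N)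
    (hclose : g N = g 0)
    (hinj : ∀ i j, 0 ≤ i → i < N → 0 ≤ j → j < N → g i = g j → i = j) :
    WindsCycle R (fun i => g (i % N)) N := by
  refine ⟨hN, fun i j => ⟨fun h => ?_, fun h => ?_⟩, fun i => ?_⟩
  · have := hinj _ _ (Int.emod_nonneg i hN.ne') (Int.emod_lt_of_pos i hN)
      (Int.emod_nonneg j hN.ne') (Int.emod_lt_of_pos j hN) h
    exact Int.ModEq.dvd (show j ≡ i [ZMOD N] from this.symm)
  · have : j % N = i % N := (Int.modEq_iff_dvd).mpr h
    simp only [this]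
  · have h1 := Int.emod_nonneg i hN.ne'
    have h2 := Int.emod_lt_of_pos i hN
    have h3 := hg _ h1 h2
    have h4 : (i + 1) % N = (i % N + 1) % N := by simp
    simp only [h4]
    rcases lt_or_eq_of_le (Int.add_one_le_iff.mpr h2) with h | h
    · rwa [Int.emod_eq_of_lt (by omega) h]
    · rw [h] at h3 ⊢
      rwa [Int.emod_self, ← hclose]

lemma windsCycle_append {a b : ℤ → V} {p q : ℤ} (hp : 0 < p) (hq : 0 < q)
    (ha : IsWalk R a p) (hb : IsWalk R b q) (hab : a p = b 0) (hba : b q = a 0)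
    (hainj : ∀ i j, 0 ≤ i → i ≤ p → 0 ≤ j → j ≤ p → a i = a j → i = j)
    (hbinj : ∀ i j, 0 ≤ i → i ≤ q → 0 ≤ j → j ≤ q → b i = b j → i = j)
    (hdisj : ∀ i s, 0 < i → i < p → 0 < s → s < q → a i ≠ b s) :
    ∃ w : ℤ → V, WindsCycle R w (p + q) ∧ w 0 = a 0 ∧ w p = a p := by
  have hmix : ∀ i s, 0 ≤ i → i < p → 0 ≤ s → s < q → a i ≠ b s := by
    intro i s h1 h2 h3 h4 he
    rcases h1.eq_or_lt with rfl | h1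
    · have := hbinj q s hq.le le_rfl h3 h4.le (hba.trans he); omega
    rcases h3.eq_or_lt with rfl | h3
    · have := hainj i p h1.le h2.le hp.le le_rfl (he.trans hab.symm); omega
    exact hdisj i s h1 h2 h3 h4 he
  refine ⟨_, windsCycle_of_closed_walk (g := fun t => if t < p then a t else b (t - p))
    (by omega) (fun t h1 h2 => ?_) ?_ fun i j hi hi' hj hj' he => ?_, ?_, ?_⟩
  · rcases lt_trichotomy (t + 1) p with h | h | h
    · simpa [h, show t < p by omega] using ha t h1 (by omega)
    · have := ha t h1 (by omega)
      rw [h, hab] at this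
      simpa [h, show t < p by omega] using this
    · have := hb (t - p) (by omega) (by omega)
      simp only [show ¬ t < p by omega, show ¬ t + 1 < p by omega, if_false]
      convert this using 2; omega
  · simp [hp, hba, hq.le]
  · by_cases h1 : i < p <;> by_cases h2 : j < p <;> simp only [h1, h2, if_true, if_false] at he
    · exact hainj i j hi h1.le hj h2.le he
    · exact absurd he (hmix _ _ hi h1 (by omega) (by omega))
    · exact absurd he.symm (hmix _ _ hj h2 (by omega) (by omega))
    · have := hbinj _ _ (by omega) (by omega) (by omega) (by omega) he
      omega
  · simp [hp]
  · simp [Int.emod_eq_of_lt hp.le (show p < p + q by omega), hab]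

theorem exists_windsCycle (hσ : SkewInvolution R σ) (hU : Contradictory R σ)
    (hM : Critical R σ) :
    ∃ (w : ℤ → V) (N d : ℤ), WindsCycle R w N ∧ 0 < d ∧ d < N ∧ w d = σ (w 0) := by
  obtain ⟨p, a, hp, ha, hap, hr, hainj, hclash⟩ := exists_clash_free_path hσ hU
  obtain ⟨q, b, hq0, hb, hb0, hbq, hbinj⟩ := exists_path hr
  have hq : 0 < q := by
    rcases hq0.eq_or_lt with rfl | h
    · exact absurd (hbq.symm.trans hb0).symm (hσ.ne _)
    · exact h
  have hback : ∀ E : V → V → Prop, (∀ i, 0 ≤ i → i < q → E (b i) (b (i + 1))) →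
      ReflTransGen (skewClosure σ E) (σ (a 0)) (a 0) := by
    intro E hE
    have := reach_of_arcs (H := skewClosure σ E) hq.le fun i h1 h2 => .inl (hE i h1 h2)
    rwa [hb0, hbq] at this
  have hclash' : ∀ i j, 0 < i → i < p → 0 < j → j < p → a j ≠ σ (a i) := by
    intro i j hi hi' hj hj' he
    rcases lt_trichotomy i j with h | rfl | h
    · exact hclash i j hi.le h hj' he
    · exact hσ.ne _ he.symm
    · exact hclash j i hj.le h hi' (by rw [he, hσ.invol])
  have hone : (∀ i s, 0 < i → i < p → 0 < s → s < q → a i ≠ b s) ∨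
      (∀ j t, 0 < j → j < p → 0 < t → t < q → a j ≠ σ (b t)) := by
    by_contra hcon
    push Not at hcon
    obtain ⟨⟨i, s, hi, hip, hs, hsq, his⟩, j, t, hj, hjp, ht, htq, hjt⟩ := hcon
    let E (lo hi : ℤ) : V → V → Prop := fun x y =>
      (∃ m, lo ≤ m ∧ m < hi ∧ x = a m ∧ y = a (m + 1)) ∨
      (∃ m, 0 ≤ m ∧ m < q ∧ x = b m ∧ y = b (m + 1))
    have hER : ∀ lo hi, 0 ≤ lo → hi ≤ p → ∀ x y, E lo hi x y → R x y := by
      rintro lo hi h1 h2 x y (⟨m, h3, h4, rfl, rfl⟩ | ⟨m, h3, h4, rfl, rfl⟩)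
      · exact ha m (by omega) (by omega)
      · exact hb m h3 h4
    have hEa : ∀ lo hi m n, lo ≤ m → m ≤ n → n ≤ hi →
        ReflTransGen (skewClosure σ (E lo hi)) (a m) (a n) := fun lo hi m n h1 h2 h3 =>
      reach_of_arcs h2 fun k h4 h5 => .inl (.inl ⟨k, by omega, by omega, rfl, rfl⟩)
    have hEb : ∀ lo hi m n, 0 ≤ m → m ≤ n → n ≤ q →
        ReflTransGen (skewClosure σ (E lo hi)) (b m) (b n) := fun lo hi m n h1 h2 h3 =>
      reach_of_arcs h2 fun k h4 h5 => .inl (.inr ⟨k, by omega, by omega, rfl, rfl⟩)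
    have hEc : ∀ lo hi, ReflTransGen (skewClosure σ (E lo hi)) (σ (a 0)) (a 0) :=
      fun lo hi => hback _ fun k h4 h5 => .inr ⟨k, h4, h5, rfl, rfl⟩
    have hjt' : b t = σ (a j) := by rw [hjt, hσ.invol]
    rcases le_total s t with hst | hst
    · have hreach : ReflTransGen (skewClosure σ (E 0 (p - 1))) (a 0) (σ (a 0)) := by
        refine (hEa 0 (p - 1) 0 i le_rfl hi.le (by omega)).trans ?_
        have h1 := hEb 0 (p - 1) s t hs.le hst htq.le
        rw [← his, hjt'] at h1
        exact h1.trans (SkewInvolution.reach_rev hσ.invol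
          (hEa 0 (p - 1) 0 j le_rfl hj.le (by omega)))
      have hlast := hM _ (hER 0 (p - 1) le_rfl (by omega)) ⟨_, hreach, hEc _ _⟩
        (a (p - 1)) (a (p - 1 + 1)) (ha _ (by omega) (by omega))
      rw [sub_add_cancel] at hlast
      rcases hlast with (⟨m, h1, h2, h3, -⟩ | ⟨m, h1, h2, -, h3⟩) |
        (⟨m, h1, h2, h3, h4⟩ | ⟨m, h1, h2, h3, -⟩)
      · have := hainj _ _ (by omega) (by omega) (by omega) (by omega) h3; omega
      · rw [hap, ← hb0] at h3
        have := hbinj _ _ (by omega) (by omega) (by omega) (by omega) h3; omega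
      · exact hclash' (p - 1) (m + 1) (by omega) (by omega) (by omega) (by omega) h4.symm
      · rw [hap, hσ.invol, ← hbq] at h3
        have := hbinj _ _ (by omega) (by omega) (by omega) (by omega) h3; omega
    · have hreach : ReflTransGen (skewClosure σ (E 1 p)) (a 0) (σ (a 0)) := by
        have h0 := SkewInvolution.reach_rev hσ.invol (hEa 1 p j p (by omega) hjp.le le_rfl)
        rw [hap, hσ.invol] at h0
        have h1 := hEb 1 p t s ht.le hst hsq.le
        rw [← his, hjt'] at h1
        have h2 := hEa 1 p i p (by omega) hip.le le_rfl
        rw [hap] at h2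
        exact (h0.trans h1).trans h2
      have hfirst := hM _ (hER 1 p (by omega) le_rfl) ⟨_, hreach, hEc _ _⟩
        (a 0) (a (0 + 1)) (ha _ (by omega) (by omega))
      rw [zero_add] at hfirst
      rcases hfirst with (⟨m, h1, h2, h3, -⟩ | ⟨m, h1, h2, h3, -⟩) |
        (⟨m, h1, h2, h3, h4⟩ | ⟨m, h1, h2, -, h3⟩)
      · have := hainj _ _ (by omega) (by omega) (by omega) (by omega) h3; omega
      · rw [← hbq] at h3
        have := hbinj _ _ (by omega) (by omega) (by omega) (by omega) h3; omega
      · exact hclash' 1 m (by omega) (by omega) (by omega) (by omega) h3.symm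
      · rw [← hb0] at h3
        have := hbinj _ _ (by omega) (by omega) (by omega) (by omega) h3; omega
  rcases hone with h | h
  · obtain ⟨w, hw, h0, h1⟩ := windsCycle_append hp hq ha hb (hap.trans hb0.symm) hbq hainj hbinj h
    exact ⟨w, p + q, p, hw, hp, by omega, by rw [h1, h0, hap]⟩
  · obtain ⟨w, hw, h0, h1⟩ := windsCycle_append (b := fun t => σ (b (q - t))) hp hq ha
      (fun t h1 h2 => by
        have := hσ.rev _ _ (hb (q - (t + 1)) (by omega) (by omega))
        rwa [show q - (t + 1) + 1 = q - t by omega] at this)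
      (by simp [hap, hbq]) (by simp [hb0, hσ.invol]) hainj
      (fun i j h1 h2 h3 h4 he => by
        have := hbinj _ _ (by omega) (by omega) (by omega) (by omega) (hσ.injective he)
        omega)
      (fun i s h1 h2 h3 h4 => h i (q - s) h1 h2 (by omega) (by omega))
    exact ⟨w, p + q, p, hw, hp, by omega, by rw [h1, h0, hap]⟩

namespace WindsCycle

variable {w : ℤ → V} {N : ℤ}

lemma congr_arg (hw : WindsCycle R w N) {i j : ℤ} (h : N ∣ i - j) : w i = w j := (hw.inj i j).2 h

lemma shift (hw : WindsCycle R w N) {i j : ℤ} (h : w i = w j) (t : ℤ) : w (i + t) = w (j + t) :=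
  hw.congr_arg (by simpa using (hw.inj i j).1 h)

lemma add_period (hw : WindsCycle R w N) (i : ℤ) : w (i + N) = w i := hw.congr_arg (by simp)

lemma add_mul_period (hw : WindsCycle R w N) (i k : ℤ) : w (i + k * N) = w i :=
  hw.congr_arg (by simp)

lemma cover (hw : WindsCycle R w N) (hM : Critical R σ) {i j : ℤ} (h : w j = σ (w i))
    (a b : V) (hab : R a b) :
    (∃ s, a = w s ∧ b = w (s + 1)) ∨ (∃ s, a = σ (w (s + 1)) ∧ b = σ (w s)) ∨
      (∃ s, σ b = w s ∧ σ a = w (s + 1)) := by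
  let E : V → V → Prop := fun a b => ∃ s, a = w s ∧ b = w (s + 1)
  have hreach : ∀ m n, ReflTransGen (skewClosure σ E) (w m) (w n) := by
    intro m n
    obtain ⟨k, hk⟩ : ∃ k : ℤ, m ≤ n + k * N := by
      refine ⟨|m - n|, ?_⟩
      have := le_abs_self (m - n)
      nlinarith [hw.pos, abs_nonneg (m - n)]
    rw [← hw.add_mul_period n k]
    exact reach_of_arcs hk fun s _ _ => .inl ⟨s, rfl, rfl⟩
  have := hM E (by rintro _ _ ⟨s, rfl, rfl⟩; exact hw.arc s)
    ⟨w i, h ▸ hreach i j, h ▸ hreach j i⟩ a b hab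
  rcases this with h | h
  · exact .inl h
  · exact .inr (.inr h)

/-- A skew involution reversing a stretch of the cycle fixes a vertex or has a unit arc. -/
lemma not_reversed (hw : WindsCycle R w N) (hσ : SkewInvolution R σ)
    (hunit : ∀ x, ¬ R x (σ x)) {e L : ℤ} (hL : 0 ≤ L)
    (h : ∀ u, 0 ≤ u → u ≤ L → σ (w (e + u)) = w (e + (L - u))) : False := by
  obtain ⟨m, hm | hm⟩ := Int.even_or_odd' L
  · have := h m (by omega) (by omega)
    rw [show L - m = m by omega] at this
    exact hσ.ne _ this
  · have := h m (by omega) (by omega)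
    rw [show L - m = m + 1 by omega, ← add_assoc] at this
    exact hunit _ (this ▸ hw.arc (e + m))

/-- Two non-crossing chords bound stretches that are `σ`-reversals of each other. -/
lemma noncrossing (hw : WindsCycle R w N) (hσ : SkewInvolution R σ) (hM : Critical R σ)
    {i i' j j' : ℤ} (h1 : i < i') (h2 : i' < j) (h3 : j < j') (h4 : j' < i + N)
    (hi : w i' = σ (w i)) (hj : w j' = σ (w j)) {u : ℤ} (hu : 0 ≤ u) (hu' : u ≤ i + N - j') :
    w (j' + u) = σ (w (j - u)) := by
  let E : V → V → Prop := fun a b => ∃ s, i ≤ s ∧ s < j' ∧ a = w s ∧ b = w (s + 1)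
  have hreach : ∀ m n, i ≤ m → m ≤ n → n ≤ j' → ReflTransGen (skewClosure σ E) (w m) (w n) :=
    fun m n h1 h2 h3 => reach_of_arcs h2 fun s _ _ => .inl ⟨s, by omega, by omega, rfl, rfl⟩
  have hcov := hM E (by rintro _ _ ⟨s, _, _, rfl, rfl⟩; exact hw.arc s) ⟨w i, by
      simpa only [hi] using hreach i i' le_rfl h1.le (by omega), by
      have h5 := hreach i' j' h1.le (by omega) le_rfl
      have h6 := SkewInvolution.reach_rev hσ.invol (hreach i' j (by omega) h2.le h3.le)
      rw [hi, hσ.invol] at h6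
      rw [hi, hj] at h5
      exact h5.trans h6⟩
  induction u, hu using Int.leInduction with
  | base => simpa using hj
  | succ u hu ih =>
    have ih := ih (by omega)
    rcases hcov _ _ (hw.arc (j' + u)) with ⟨s, hs, hs', h5, -⟩ | ⟨s, hs, hs', h5, h6⟩
    · obtain ⟨k, hk⟩ := (hw.inj _ _).1 h5
      have hk0 : 0 < k := by nlinarith [hw.pos]
      have hk1 : k < 1 := by nlinarith [hw.pos]
      omega
    · rw [ih, hσ.invol] at h6
      have h7 := hw.shift h6 (-1)
      rw [add_neg_cancel_right, ← h5] at h7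
      rw [← add_assoc, show j - (u + 1) = j - u + -1 by ring, h7, hσ.invol]

/-- A second critical skew-symmetry carries the cycle onto the same reversed cycle. -/
lemma exists_rotation (hw : WindsCycle R w N) (hσ : SkewInvolution R σ) (hτ : SkewInvolution R τ)
    (hσu : ∀ x, ¬ R x (σ x)) (hMσ : Critical R σ) (hMτ : Critical R τ)
    {d : ℤ} (hd : 0 < d) (hwd : w d = σ (w 0)) : ∃ c, ∀ i, τ (w i) = σ (w (i + c)) := by
  have hcovσ : ∀ a b, R a b →
      (∃ s, a = w s ∧ b = w (s + 1)) ∨ (∃ s, a = σ (w (s + 1)) ∧ b = σ (w s)) := by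
    intro a b hab
    rcases hw.cover hMσ hwd a b hab with h | h | ⟨s, h1, h2⟩
    · exact .inl h
    · exact .inr h
    · exact .inr ⟨s, by rw [← h2, hσ.invol], by rw [← h1, hσ.invol]⟩
  by_cases hmeet : ∃ i j, w j = τ (w i)
  · obtain ⟨i, j, hij⟩ := hmeet
    have hcovτ : ∀ a b, R a b →
        (∃ s, a = w s ∧ b = w (s + 1)) ∨ (∃ s, a = τ (w (s + 1)) ∧ b = τ (w s)) := by
      intro a b hab
      rcases hw.cover hMτ hij a b hab with h | h | ⟨s, h1, h2⟩
      · exact .inl h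
      · exact .inr h
      · exact .inr ⟨s, by rw [← h2, hτ.invol], by rw [← h1, hτ.invol]⟩
    obtain ⟨i₀, hi₀⟩ : ∃ i₀, ¬ ∃ s, σ (w (i₀ + 1)) = w s ∧ σ (w i₀) = w (s + 1) := by
      by_contra hall
      push Not at hall
      refine hw.not_reversed hσ hσu (e := 0) hd.le fun u hu _ => ?_
      induction u, hu using Int.leInduction with
      | base => simpa using hwd.symm
      | succ u hu ih =>
        have ih := ih (by omega)
        obtain ⟨s, h1, h2⟩ := hall (0 + u)
        have h3 := hw.shift (h2.symm.trans ih) (-1)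
        rw [add_neg_cancel_right] at h3
        rw [← add_assoc, h1, h3]; congr 1; ring
    obtain ⟨t₀, h1, h2⟩ : ∃ t₀, σ (w (i₀ + 1)) = τ (w (t₀ + 1)) ∧ σ (w i₀) = τ (w t₀) := by
      rcases hcovτ _ _ (hσ.rev _ _ (hw.arc i₀)) with h | h
      · exact absurd h hi₀
      · exact h
    have hdown : ∀ t, t ≤ t₀ → τ (w t) = σ (w (t + (i₀ - t₀))) := by
      intro t ht
      induction t, ht using Int.leInductionDown with
      | base => rw [add_sub_cancel, h2]
      | pred t ht ih =>
        have hσarc := hσ.rev _ _ (hw.arc (t + (i₀ - t₀) - 1))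
        have hτarc := hτ.rev _ _ (hw.arc (t - 1))
        rw [sub_add_cancel] at hσarc hτarc
        rw [show t - 1 + (i₀ - t₀) = t + (i₀ - t₀) - 1 by ring]
        have hback : ∀ {m n}, w m = w (n + 1) → w n = w (m - 1) := fun {m n} h => by
          have := hw.shift h (-1)
          rw [add_neg_cancel_right] at this
          exact this.symm
        rcases hcovτ _ _ hσarc with ⟨s, h3, h4⟩ | ⟨s, h3, h4⟩
        · rcases hcovσ _ _ hτarc with ⟨r, h5, h6⟩ | ⟨r, h5, h6⟩
          · rw [h4, h6]
            exact hw.shift (by rw [← h5, ← h3, ih]) 1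
          · rw [h6, hback (hσ.injective (ih.symm.trans h5))]
        · rw [h4, hback (hτ.injective (ih.trans h3))]
    refine ⟨i₀ - t₀, fun i => ?_⟩
    have hk : i + (-|i - t₀|) * N ≤ t₀ := by
      have := le_abs_self (i - t₀)
      nlinarith [hw.pos, abs_nonneg (i - t₀)]
    have := hdown _ hk
    rwa [hw.add_mul_period, add_right_comm, hw.add_mul_period] at this
  · push Not at hmeet
    have hstep : ∀ i, ∃ s, τ (w (i + 1)) = σ (w (s + 1)) ∧ τ (w i) = σ (w s) := by
      intro i
      rcases hcovσ _ _ (hτ.rev _ _ (hw.arc i)) with ⟨s, h1, -⟩ | h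
      · exact absurd h1.symm (hmeet _ _)
      · exact h
    obtain ⟨c, -, hc⟩ := hstep 0
    have hup : ∀ t, 0 ≤ t → τ (w t) = σ (w (t + c)) := by
      intro t ht
      induction t, ht using Int.leInduction with
      | base => simpa using hc
      | succ t ht ih =>
        obtain ⟨s, h1, h2⟩ := hstep t
        rw [h1, add_right_comm, hw.shift (hσ.injective (h2.symm.trans ih)) 1]
    refine ⟨c, fun i => ?_⟩
    have hk : 0 ≤ i + |i| * N := by
      have := neg_abs_le i
      nlinarith [hw.pos, abs_nonneg i]
    have := hup _ hk
    rwa [hw.add_mul_period, add_right_comm, hw.add_mul_period] at this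

/-- If the chord relation holds on a full period of a rotation, then `σ` reverses the cycle. -/
lemma not_reversed_of_shift (hw : WindsCycle R w N) (hσ : SkewInvolution R σ)
    (hunit : ∀ x, ¬ R x (σ x)) {d e s : ℤ} (hd : 0 ≤ d) (hs : 0 < s)
    (hstep : ∀ u, σ (w u) = w (d - u) → σ (w (u + s)) = w (d - (u + s)))
    (h : ∀ u, e ≤ u → u ≤ e + s → σ (w u) = w (d - u)) : False := by
  have hmul : ∀ (k : ℕ) u, e ≤ u → u ≤ e + s → σ (w (u + k * s)) = w (d - (u + k * s)) := by
    intro k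
    induction k with
    | zero => simpa using h
    | succ k ih =>
      intro u h1 h2
      have := hstep _ (ih u h1 h2)
      rwa [show u + k * s + s = u + (k + 1 : ℕ) * s by push_cast; ring] at this
  have hall : ∀ u, e ≤ u → σ (w u) = w (d - u) := by
    intro u hu
    have h1 := Int.emod_nonneg (u - e) hs.ne'
    have h2 := Int.emod_lt_of_pos (u - e) hs
    have h3 : 0 ≤ (u - e) / s := Int.ediv_nonneg (by omega) hs.le
    have h4 := hmul ((u - e) / s).toNat (e + (u - e) % s) (by omega) (by omega)
    have h5 : e + (u - e) % s + ((u - e) / s) * s = u := by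
      have := Int.emod_add_mul_ediv (u - e) s
      linarith
    rwa [Int.toNat_of_nonneg h3, h5] at h4
  refine hw.not_reversed hσ hunit (e := 0) hd fun u hu hu' => ?_
  have h1 : e ≤ u + |e| * N := by
    have := le_abs_self e
    nlinarith [hw.pos, abs_nonneg e]
  have h2 := hall _ h1
  rw [hw.add_mul_period, show d - (u + |e| * N) = d - u + (-|e|) * N by ring,
    hw.add_mul_period] at h2
  simpa using h2

lemma rotation_trivial (hw : WindsCycle R w N) (hσ : SkewInvolution R σ)
    (hτ : SkewInvolution R τ) (hσu : ∀ x, ¬ R x (σ x)) (hτu : ∀ x, ¬ R x (τ x))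
    (hM : Critical R σ) {d : ℤ} (hd : 0 < d) (hdN : d < N) (hwd : w d = σ (w 0)) {c : ℤ}
    (hc : ∀ i, τ (w i) = σ (w (i + c))) (hc0 : 0 < c) (hcN : c < N) : False := by
  have hshift : ∀ m m', w m' = σ (w m) → w (m' - c) = σ (w (m + c)) := by
    intro m m' h
    rw [← hc m]
    have h1 := hc (m' - c)
    rw [sub_add_cancel, h, hσ.invol] at h1
    rw [← h1, hτ.invol]
  have hchord := hshift 0 d hwd
  rw [zero_add] at hchord
  have hchord' : w c = σ (w (d - c)) := by rw [hchord, hσ.invol]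
  have hwd' : w N = σ (w d) := by
    rw [hwd, hσ.invol, ← hw.add_period 0, zero_add]
  have hchordN : w (d - c + N) = σ (w c) := by rw [hw.add_period, hchord]
  rcases lt_trichotomy c d with hcd | rfl | hcd
  · rcases lt_trichotomy (2 * c) d with h | h | h
    · refine hw.not_reversed_of_shift hσ hσu hd.le hc0 (e := 0) (fun u hu => ?_) fun u h1 h2 => ?_
      · rw [← hshift _ _ hu.symm]; congr 1; ring
      · have h3 := hw.noncrossing hσ hM (by omega) (by omega) hdN (by omega) hchord hwd'
          (u := u) h1 (by omega)
        rw [add_comm, hw.add_period] at h3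
        rw [h3, hσ.invol]
    · exact hσ.ne (w c) (by rw [← hchord]; congr 1; omega)
    · refine hw.not_reversed hτ hτu (e := 0) (L := d - c) (by omega) fun u h1 h2 => ?_
      have h3 := hw.noncrossing hσ hM (i := d - c) (i' := c) (by omega) (by omega) hdN (by omega)
        hchord' hwd' (u := d - c - u) (by omega) (by omega)
      rw [add_comm, hw.add_period] at h3
      rw [hc, zero_add, zero_add, h3]; congr 2; ring
  · have h1 := hc 0
    rw [zero_add, hwd, hσ.invol] at h1
    exact hτ.ne _ h1
  · rcases lt_trichotomy (2 * c) (d + N) with h | h | h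
    · refine hw.not_reversed hτ hτu (e := d - c) (L := c - d) (by omega) fun u h1 h2 => ?_
      have h3 := hw.noncrossing hσ hM (i := 0) (i' := d) hd hcd (j' := d - c + N)
        (by omega) (by omega) hwd hchordN (u := c - d - u) (by omega) (by omega)
      rw [add_right_comm, hw.add_period] at h3
      rw [hc, h3]; congr 2; ring
    · exact hσ.ne (w c) (by rw [← hchordN]; congr 1; omega)
    · refine hw.not_reversed_of_shift hσ hσu hd.le (s := N - c) (by omega) (e := c)
        (fun u hu => ?_) fun u h1 h2 => ?_
      · have h1 := hshift (d - u) u (by rw [← hu, hσ.invol])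
        rw [show u + (N - c) = u - c + N by ring, hw.add_period, h1, hσ.invol,
          show d - (u - c + N) = d - u + c + (-1) * N by ring, hw.add_mul_period]
      · have h3 := hw.noncrossing hσ hM (i := 0) (i' := d) hd (j := d - c + N) (j' := c)
          (by omega) (by omega) (by omega) hwd (by rw [hw.add_period, hchord'])
          (u := u - c) (by omega) (by omega)
        rw [add_sub_cancel] at h3
        rw [h3, hσ.invol, show d - c + N - (u - c) = d - u + N by ring, hw.add_period]

end WindsCycle

/-- Unit-free critical skew-symmetries of a relation are unique. -/
theorem critical_skewInvolution_unique (hσ : SkewInvolution R σ) (hτ : SkewInvolution R τ)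
    (hσu : ∀ x, ¬ R x (σ x)) (hτu : ∀ x, ¬ R x (τ x)) (hU : Contradictory R σ)
    (hMσ : Critical R σ) (hMτ : Critical R τ) {a b : V} (hab : R a b) : τ a = σ a := by
  obtain ⟨w, N, d, hw, hd, hdN, hwd⟩ := exists_windsCycle hσ hU hMσ
  obtain ⟨c, hc⟩ := hw.exists_rotation hσ hτ hσu hMσ hMτ hd hwd
  have hmod : ∀ i, τ (w i) = σ (w (i + c % N)) := by
    intro i
    rw [hc]
    congr 1
    refine hw.congr_arg ?_
    rw [add_sub_add_left_eq_sub]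
    exact Int.dvd_self_sub_emod
  have heq : ∀ i, τ (w i) = σ (w i) := by
    rcases (Int.emod_nonneg c hw.pos.ne').eq_or_lt with h | h
    · simpa [← h] using hmod
    · exact (hw.rotation_trivial hσ hτ hσu hτu hMσ hd hdN hwd hmod h
        (Int.emod_lt_of_pos c hw.pos)).elim
  have heq' : ∀ i, τ (σ (w i)) = σ (σ (w i)) := by
    intro i
    rw [← heq, hτ.invol, heq, hσ.invol]
  rcases hw.cover hMσ hwd a b hab with ⟨s, rfl, -⟩ | ⟨s, rfl, -⟩ | ⟨s, -, h⟩
  · exact heq s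
  · exact heq' _
  · rw [← hσ.invol a, h]
    exact heq' _

/-- In the presence of a unit arc, a critical relation is covered by that arc and a walk
whose starting points of arcs are pairwise distinct and clash-free. -/
theorem cover_of_unit (hσ : SkewInvolution R σ) (hU : Contradictory R σ) (hM : Critical R σ)
    {u : V} (hu : R u (σ u)) :
    ∃ (p : ℕ) (w : ℕ → V), (∀ i < p, R (w i) (w (i + 1))) ∧
      (∀ i < p, ∀ j < p, w i = w j ∨ w i = σ (w j) → i = j) ∧
      ∀ a b, R a b → skewClosure σ (fun x y =>
        (∃ i < p, x = w i ∧ y = w (i + 1)) ∨ (x = u ∧ y = σ u)) a b := by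
  classical
  obtain ⟨w, N, d, hw, hd, hdN, hwd⟩ := exists_windsCycle hσ hU hM
  obtain ⟨t, ht, ht'⟩ : ∃ t, w t = u ∧ w (t + 1) = σ u := by
    rcases hw.cover hM hwd _ _ hu with ⟨s, h1, h2⟩ | ⟨s, h1, h2⟩ | ⟨s, h1, h2⟩
    · exact ⟨s, h1.symm, h2.symm⟩
    · exact ⟨s, hσ.injective h2.symm, by rw [h1, hσ.invol]⟩
    · exact ⟨s, by rw [← h1, hσ.invol], h2.symm⟩
  let v : ℕ → V := fun n => w (t + 1 + n)
  have hv0 : v 0 = σ u := by simp [v, ht']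
  have hN2 : 2 ≤ N := by omega
  have hlast : ∃ q < (N - 1).toNat, v (N - 1).toNat = σ (v q) := by
    refine ⟨0, by omega, ?_⟩
    rw [hv0, hσ.invol, ← ht]
    simp only [v]
    rw [Int.toNat_of_nonneg (by omega), show t + 1 + (N - 1) = t + N by ring, hw.add_period]
  have hex : ∃ p : ℕ, ∃ q < p, v p = σ (v q) := ⟨_, hlast⟩
  obtain ⟨q, hq, hpq⟩ := Nat.find_spec hex
  have hmin := fun m => Nat.find_min hex (m := m)
  have hle : (Nat.find hex : ℤ) < N := by
    have := Nat.find_min' hex hlast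
    omega
  generalize Nat.find hex = p at *
  have harc : ∀ i, R (v i) (v (i + 1)) := fun i => by
    simpa [v, add_assoc] using hw.arc (t + 1 + i)
  refine ⟨p, v, fun i _ => harc i, ?_, hM _ ?_ ⟨σ u, ?_, ?_⟩⟩
  · rintro i hi j hj (h | h)
    · obtain ⟨k, hk⟩ := (hw.inj _ _).1 h
      have h1 : k < 1 := by nlinarith
      have h2 : -1 < k := by nlinarith
      have : k = 0 := by omega
      subst this
      omega
    · rcases lt_trichotomy i j with h' | h' | h'
      · exact (hmin j hj ⟨i, h', by rw [h, hσ.invol]⟩).elim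
      · exact h'
      · exact (hmin i hi ⟨j, h', h⟩).elim
  · rintro _ _ (⟨i, -, rfl, rfl⟩ | ⟨rfl, rfl⟩)
    · exact harc i
    · exact hu
  all_goals
    set E : V → V → Prop := fun x y => (∃ i < p, x = v i ∧ y = v (i + 1)) ∨ (x = u ∧ y = σ u)
  · have hreach : ∀ m n, m ≤ n → n ≤ p → ReflTransGen (skewClosure σ E) (v m) (v n) := by
      intro m n hmn
      induction n, hmn using Nat.le_induction with
      | base => exact fun _ => .refl
      | succ n _ ih =>
        exact fun h => (ih (by omega)).tail (.inl (.inl ⟨n, by omega, rfl, rfl⟩))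
    have h1 := SkewInvolution.reach_rev hσ.invol (hreach 0 q (by omega) hq.le)
    rw [← hpq] at h1
    have := (hreach 0 p (by omega) le_rfl).trans h1
    rwa [hv0] at this
  · rw [hσ.invol]
    exact .single (.inl (.inr ⟨rfl, rfl⟩))

end SkewSymmetric


/-- The implication relation of a 2-clause-set. -/
def implies (F : Finset (Finset Lit)) (a b : Lit) : Prop := insert (Lit.compl a) {b} ∈ F

lemma Lit.compl_compl (x : Lit) : Lit.compl (Lit.compl x) = x := by simp [Lit.compl]

lemma Lit.compl_ne (x : Lit) : Lit.compl x ≠ x := by simp [Lit.compl, Prod.ext_iff]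

lemma Lit.eq_or_eq_compl {x y : Lit} (h : x.1 = y.1) : x = y ∨ x = Lit.compl y := by
  obtain ⟨x, a⟩ := x
  obtain ⟨y, b⟩ := y
  cases a <;> cases b <;> simp_all [Lit.compl]

lemma litVal_compl (φ : ℕ → Bool) (x : Lit) : LitVal φ (Lit.compl x) = !LitVal φ x := by
  obtain ⟨x, _ | _⟩ := x <;> simp [LitVal, Lit.compl]

lemma mem_litsOf {F : Finset (Finset Lit)} {C : Finset Lit} {x : Lit} (hC : C ∈ F) (hx : x ∈ C) :
    x ∈ litsOf F := by
  simp only [litsOf, varsOf, Finset.mem_product, Finset.mem_biUnion, Finset.mem_image,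
    Finset.mem_univ, and_true]
  exact ⟨C, hC, x, hx, rfl⟩

lemma implies_mem {F : Finset (Finset Lit)} {a b : Lit} (h : implies F a b) :
    a ∈ litsOf F ∧ b ∈ litsOf F := by
  refine ⟨?_, mem_litsOf h (by simp)⟩
  simpa [Lit.compl_compl] using compl_mem (mem_litsOf h (Finset.mem_insert_self _ _))

lemma mem_idg {F : Finset (Finset Lit)} {a b : Lit} : (a, b) ∈ (idg F).E ↔ implies F a b := by
  simp only [idg, Finset.mem_filter, Finset.mem_product]
  exact ⟨fun h => h.2, fun h => ⟨implies_mem h, h⟩⟩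

lemma skewInvolution_compl (F : Finset (Finset Lit)) : SkewInvolution (implies F) Lit.compl := by
  refine ⟨Lit.compl_compl, Lit.compl_ne, fun a b h => ?_⟩
  simpa only [implies, Lit.compl_compl, Finset.pair_comm] using h

lemma insert_compl_eq {a b c d : Lit}
    (h : (insert (Lit.compl a) {b} : Finset Lit) = insert (Lit.compl c) {d}) :
    (a = c ∧ b = d) ∨ (a = Lit.compl d ∧ b = Lit.compl c) := by
  have h1 : ∀ x y, Lit.compl x = Lit.compl y ↔ x = y := fun x y =>
    ⟨fun h => by rw [← Lit.compl_compl x, h, Lit.compl_compl], fun h => by rw [h]⟩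
  have h2 : ∀ x y, Lit.compl x = y ↔ x = Lit.compl y := fun x y => by
    rw [← h1 (Lit.compl x), Lit.compl_compl]
  have := congrArg (fun s : Finset Lit => (s : Set Lit)) h
  simp only [Finset.coe_insert, Finset.coe_singleton, Set.pair_eq_pair_iff, h1, h2] at this
  simpa only [h2] using this

lemma MU2.eq_arc {F : Finset (Finset Lit)} (hF : MU2 F) (h0 : ∅ ∉ F) {C : Finset Lit}
    (hC : C ∈ F) : ∃ a b, C = insert (Lit.compl a) {b} := by
  have hpos : C.card ≠ 0 := fun h => h0 (Finset.card_eq_zero.mp h ▸ hC)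
  have hle := hF.2 C hC
  obtain h | h : C.card = 1 ∨ C.card = 2 := by omega
  · obtain ⟨x, rfl⟩ := Finset.card_eq_one.mp h
    exact ⟨Lit.compl x, x, by simp [Lit.compl_compl]⟩
  · obtain ⟨x, y, -, rfl⟩ := Finset.card_eq_two.mp h
    exact ⟨Lit.compl x, y, by rw [Lit.compl_compl]⟩

/-- A 2-clause-set without contradictory literals has a consistent, implication-closed,
complete set of literals, and hence is satisfiable. -/
lemma MU2.contradictory {F : Finset (Finset Lit)} (hF : MU2 F) (h0 : ∅ ∉ F) :
    Contradictory (implies F) Lit.compl := by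
  classical
  by_contra hcon
  have hσ := skewInvolution_compl F
  let S : Set (Set Lit) :=
    {T | (∀ x ∈ T, ∀ y, implies F x y → y ∈ T) ∧ ∀ x ∈ T, Lit.compl x ∉ T}
  obtain ⟨T, hT⟩ : ∃ T, Maximal (· ∈ S) T := by
    refine zorn_subset S fun c hc hchain => ⟨⋃₀ c, ⟨?_, ?_⟩, fun s => Set.subset_sUnion_of_mem⟩
    · rintro x ⟨t, ht, hx⟩ y hxy
      exact ⟨t, ht, (hc ht).1 x hx y hxy⟩
    · rintro x ⟨t, ht, hx⟩ ⟨t', ht', hx'⟩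
      rcases hchain.total ht ht' with h | h
      · exact (hc ht').2 x (h hx) hx'
      · exact (hc ht).2 x hx (h hx')
  have hreach : ∀ x ∈ T, ∀ y, Relation.ReflTransGen (implies F) x y → y ∈ T := by
    intro x hx y hxy
    induction hxy with
    | refl => exact hx
    | tail _ h ih => exact hT.prop.1 _ ih _ h
  have hext : ∀ x, ¬ Relation.ReflTransGen (implies F) x (Lit.compl x) → Lit.compl x ∉ T →
      x ∈ T := by
    intro x hx hxT
    have hmem : T ∪ {y | Relation.ReflTransGen (implies F) x y} ∈ S := by
      refine ⟨?_, ?_⟩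
      · rintro y (hy | hy) z hyz
        · exact .inl (hT.prop.1 y hy z hyz)
        · exact .inr (hy.tail hyz)
      · rintro y (hy | hy) (hy' | hy')
        · exact hT.prop.2 y hy hy'
        · have := reach_rev_self hσ hy'
          rw [Lit.compl_compl] at this
          exact hxT (hreach y hy _ this)
        · exact hxT (hreach _ hy' _ (reach_rev_self hσ hy))
        · have := reach_rev_self hσ hy'
          rw [Lit.compl_compl] at this
          exact hx (Relation.ReflTransGen.trans hy this)
    exact hT.le_of_ge hmem Set.subset_union_left (.inr .refl)
  have htotal : ∀ x, x ∈ T ∨ Lit.compl x ∈ T := by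
    intro x
    by_contra! hx
    have h1 : Relation.ReflTransGen (implies F) x (Lit.compl x) := by
      by_contra h
      exact hx.1 (hext x h hx.2)
    have h2 : Relation.ReflTransGen (implies F) (Lit.compl x) x := by
      by_contra h
      exact hx.2 (hext _ (by rwa [Lit.compl_compl]) (by rw [Lit.compl_compl]; exact hx.1))
    exact hcon ⟨x, h1, h2⟩
  have hval : ∀ x ∈ T, LitVal (fun n => decide ((n, true) ∈ T)) x = true := by
    rintro ⟨n, _ | _⟩ hx
    · have := hT.prop.2 _ hx
      simpa [LitVal, Lit.compl] using this
    · simpa [LitVal] using hx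
  refine hF.1.2.1 ⟨fun n => decide ((n, true) ∈ T), fun C hC => ?_⟩
  obtain ⟨a, b, rfl⟩ := hF.eq_arc h0 hC
  rcases htotal a with ha | ha
  · exact ⟨b, by simp, hval b (hT.prop.1 a ha b hC)⟩
  · exact ⟨Lit.compl a, by simp, hval _ ha⟩

lemma MU2.critical {F : Finset (Finset Lit)} (hF : MU2 F) :
    Critical (implies F) Lit.compl := by
  classical
  rintro E hE ⟨x, h1, h2⟩ a b hab
  let G := F.filter fun C => ∃ a b, E a b ∧ C = insert (Lit.compl a) {b}
  have hGF : G = F := by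
    by_contra hne
    obtain ⟨φ, hφ⟩ := hF.1.2.2 G ((Finset.filter_subset _ _).ssubset_of_ne hne)
    have hstep : ∀ a b, E a b → LitVal φ (Lit.compl a) = true ∨ LitVal φ b = true := by
      intro a b hab
      obtain ⟨y, hy, hy'⟩ := hφ _ (Finset.mem_filter.2 ⟨hE a b hab, a, b, hab, rfl⟩)
      rcases Finset.mem_insert.1 hy with rfl | hy
      · exact .inl hy'
      · exact .inr (Finset.mem_singleton.1 hy ▸ hy')
    have hprop : ∀ a b, Relation.ReflTransGen (skewClosure Lit.compl E) a b →
        LitVal φ a = true → LitVal φ b = true := by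
      intro a b hab ha
      induction hab with
      | refl => exact ha
      | tail _ h ih =>
        rcases h with h | h <;> rcases hstep _ _ h with h' | h' <;>
          simp_all [litVal_compl]
    have h3 := hprop _ _ h1
    have h4 := hprop _ _ h2
    rw [litVal_compl] at h3 h4
    cases h : LitVal φ x <;> simp_all
  have hG : insert (Lit.compl a) {b} ∈ G := hGF ▸ hab
  obtain ⟨-, a', b', he, h⟩ := Finset.mem_filter.1 hG
  rcases insert_compl_eq h with ⟨rfl, rfl⟩ | ⟨rfl, rfl⟩
  · exact .inl he
  · right
    rwa [Lit.compl_compl, Lit.compl_compl]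

lemma MU2.empty_notMem {F : Finset (Finset Lit)} (hF : MU2 F) (hd : 2 ≤ deficiency F) :
    ∅ ∉ F := by
  intro h
  have hFe : {∅} = F := by
    by_contra hne
    obtain ⟨φ, hφ⟩ := hF.1.2.2 {∅} ((Finset.singleton_subset_iff.2 h).ssubset_of_ne hne)
    obtain ⟨x, hx, -⟩ := hφ ∅ (by simp)
    simp at hx
  subst hFe
  simp [deficiency, varsOf] at hd

/-- Minimally unsatisfiable 2-clause-sets of deficiency at least two have no unit-clauses. -/
lemma MU2.no_unit {F : Finset (Finset Lit)} (hF : MU2 F) (hd : 2 ≤ deficiency F) (u : Lit) :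
    ¬ implies F u (Lit.compl u) := by
  classical
  intro hu
  have h0 := hF.empty_notMem hd
  obtain ⟨p, w, harc, hinj, hcov⟩ :=
    cover_of_unit (skewInvolution_compl F) (hF.contradictory h0) hF.critical hu
  have hvars : p ≤ (varsOf F).card := by
    rw [← Finset.card_range p]
    refine Finset.card_le_card_of_injOn (fun i => (w i).1) (fun i hi => ?_) fun i hi j hj h => ?_
    · exact (Finset.mem_product.1 (implies_mem (harc i (by simpa using hi))).1).1
    · exact hinj i (by simpa using hi) j (by simpa using hj) (Lit.eq_or_eq_compl h)
  have hcard : F.card ≤ p + 1 := by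
    have hsub : F ⊆ insert (insert (Lit.compl u) {Lit.compl u})
        ((Finset.range p).image fun i => insert (Lit.compl (w i)) {w (i + 1)}) := by
      intro C hC
      obtain ⟨a, b, rfl⟩ := hF.eq_arc h0 hC
      rcases hcov a b hC with (⟨i, hi, rfl, rfl⟩ | ⟨rfl, rfl⟩) | (⟨i, hi, h1, h2⟩ | ⟨h1, h2⟩)
      · exact Finset.mem_insert_of_mem (Finset.mem_image.2 ⟨i, by simpa using hi, rfl⟩)
      · exact Finset.mem_insert_self _ _
      · refine Finset.mem_insert_of_mem (Finset.mem_image.2 ⟨i, by simpa using hi, ?_⟩)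
        rw [← h1, ← h2, Lit.compl_compl, Finset.pair_comm]
      · rw [h2, ← h1, Lit.compl_compl]
        exact Finset.mem_insert_self _ _
    refine (Finset.card_le_card hsub).trans ((Finset.card_insert_le _ _).trans ?_)
    simpa using Finset.card_image_le (s := Finset.range p)
      (f := fun i => (insert (Lit.compl (w i)) {w (i + 1)} : Finset Lit))
  simp only [deficiency] at hd
  omega

lemma DigraphIso.implies_iff {F F' : Finset (Finset Lit)} {f : Lit → Lit}
    (hf : DigraphIso (idg F) (idg F') f) {a b : Lit} (ha : a ∈ litsOf F) (hb : b ∈ litsOf F) :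
    implies F' (f a) (f b) ↔ implies F a b := by
  rw [← mem_idg, ← mem_idg, ← hf.2]
  refine ⟨fun h => ?_, fun h => Finset.mem_image_of_mem _ h⟩
  obtain ⟨⟨c, d⟩, hcd, h⟩ := Finset.mem_image.1 h
  have hmem := implies_mem (mem_idg.1 hcd)
  simp only [Prod.mk.injEq] at h
  rw [← hf.1.injOn (Finset.mem_coe.2 hmem.1) (Finset.mem_coe.2 ha) h.1,
    ← hf.1.injOn (Finset.mem_coe.2 hmem.2) (Finset.mem_coe.2 hb) h.2]
  exact hcd

/-- Digraph isomorphisms between implication digraphs commute with complementation. -/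
lemma DigraphIso.map_compl {F F' : Finset (Finset Lit)} (hF : MU2 F) (hF' : MU2 F')
    (hd : 2 ≤ deficiency F) (hd' : 2 ≤ deficiency F') {f : Lit → Lit}
    (hf : DigraphIso (idg F) (idg F') f) {x : Lit} (hx : x ∈ litsOf F) :
    f (Lit.compl x) = Lit.compl (f x) := by
  classical
  have h0 := hF.empty_notMem hd
  have hmaps : ∀ x ∈ litsOf F, f x ∈ litsOf F' := fun x hx => hf.1.mapsTo hx
  have hinj : ∀ x ∈ litsOf F, ∀ y ∈ litsOf F, f x = f y → x = y :=
    fun x hx y hy h => hf.1.injOn hx hy h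
  have hpull : ∀ x, ∃ y, (x ∈ litsOf F → y ∈ litsOf F ∧ f y = Lit.compl (f x)) ∧
      (x ∉ litsOf F → y = Lit.compl x) := by
    intro x
    by_cases hx : x ∈ litsOf F
    · obtain ⟨y, hy, hyx⟩ := hf.1.surjOn (Finset.mem_coe.2 (compl_mem (hmaps x hx)))
      exact ⟨y, fun _ => ⟨hy, hyx⟩, fun h => absurd hx h⟩
    · exact ⟨Lit.compl x, fun h => absurd h hx, fun _ => rfl⟩
  choose τ hτ hτ' using hpull
  have hcompl : ∀ x, x ∉ litsOf F → Lit.compl x ∉ litsOf F := fun x hx h =>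
    hx (by simpa [Lit.compl_compl] using compl_mem h)
  have hskew : SkewInvolution (implies F) τ := by
    refine ⟨fun x => ?_, fun x => ?_, fun a b h => ?_⟩
    · by_cases hx : x ∈ litsOf F
      · obtain ⟨h1, h2⟩ := hτ x hx
        obtain ⟨h3, h4⟩ := hτ _ h1
        exact hinj _ h3 _ hx (by rw [h4, h2, Lit.compl_compl])
      · rw [hτ' x hx, hτ' _ (hcompl x hx), Lit.compl_compl]
    · by_cases hx : x ∈ litsOf F
      · intro h
        have := (hτ x hx).2
        rw [h] at this
        exact Lit.compl_ne _ this.symm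
      · rw [hτ' x hx]
        exact Lit.compl_ne x
    · obtain ⟨ha, hb⟩ := implies_mem h
      rw [← hf.implies_iff (hτ b hb).1 (hτ a ha).1, (hτ a ha).2, (hτ b hb).2]
      exact (skewInvolution_compl F').rev _ _ ((hf.implies_iff ha hb).2 h)
  have hunit : ∀ x, ¬ implies F x (τ x) := by
    intro x h
    have hx := (implies_mem h).1
    rw [← hf.implies_iff hx (hτ x hx).1, (hτ x hx).2] at h
    exact hF'.no_unit hd' _ h
  have hcrit : Critical (implies F) τ := by
    rintro E hE ⟨x, h1, h2⟩ a b hab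
    let E' : Lit → Lit → Prop := fun a b => ∃ c d, E c d ∧ a = f c ∧ b = f d
    have hstep : ∀ a b, skewClosure τ E a b → skewClosure Lit.compl E' (f a) (f b) := by
      intro a b h
      have hR : implies F a b := skewClosure_self hskew (h.imp (hE _ _) (hE _ _))
      obtain ⟨ha, hb⟩ := implies_mem hR
      refine h.imp (fun h => ⟨a, b, h, rfl, rfl⟩) fun h => ?_
      exact ⟨_, _, h, (hτ b hb).2.symm, (hτ a ha).2.symm⟩
    have hx : x ∈ litsOf F := by
      rcases Relation.ReflTransGen.cases_head h1 with h | ⟨y, h, -⟩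
      · exact absurd h.symm (hskew.ne x)
      · exact (implies_mem (skewClosure_self hskew (h.imp (hE _ _) (hE _ _)))).1
    have h3 := Relation.ReflTransGen.lift f hstep _ _ h1
    have h4 := Relation.ReflTransGen.lift f hstep _ _ h2
    rw [Function.onFun, (hτ x hx).2] at h3 h4
    obtain ⟨ha, hb⟩ := implies_mem hab
    have hE' : ∀ a b, E' a b → implies F' a b := by
      rintro _ _ ⟨c, d, h, rfl, rfl⟩
      have hcd := hE c d h
      exact (hf.implies_iff (implies_mem hcd).1 (implies_mem hcd).2).2 hcd
    rcases hF'.critical E' hE' ⟨_, h3, h4⟩ _ _ ((hf.implies_iff ha hb).2 hab) with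
      ⟨c, d, h, h5, h6⟩ | ⟨c, d, h, h5, h6⟩ <;>
      obtain ⟨hc, hd⟩ := implies_mem (hE c d h)
    · left
      rwa [hinj a ha c hc h5, hinj b hb d hd h6]
    · right
      rw [← (hτ b hb).2] at h5
      rw [← (hτ a ha).2] at h6
      rwa [hinj _ (hτ b hb).1 c hc h5, hinj _ (hτ a ha).1 d hd h6]
  have hτσ : ∀ y b, implies F y b → τ y = Lit.compl y := fun y b h =>
    critical_skewInvolution_unique (skewInvolution_compl F) hskew (hF.no_unit hd) hunit
      (hF.contradictory h0) hF.critical hcrit h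
  have hbar : ∀ y, τ (Lit.compl y) = y → τ y = Lit.compl y := fun y h => by
    rw [← hskew.invol (Lit.compl y), h]
  have hτx : τ x = Lit.compl x := by
    obtain ⟨C, hC, hxC⟩ : ∃ C ∈ F, x ∈ C ∨ Lit.compl x ∈ C := by
      simp only [litsOf, varsOf, Finset.mem_product, Finset.mem_biUnion, Finset.mem_image] at hx
      obtain ⟨⟨C, hC, y, hy, hyx⟩, -⟩ := hx
      refine ⟨C, hC, ?_⟩
      rcases Lit.eq_or_eq_compl hyx with rfl | rfl
      · exact .inl hy
      · exact .inr hy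
    obtain ⟨a, b, rfl⟩ := hF.eq_arc h0 hC
    have h1 := hτσ a b hC
    have h2 := hτσ _ _ ((skewInvolution_compl F).rev _ _ hC)
    rw [Lit.compl_compl] at h2
    simp only [Finset.mem_insert, Finset.mem_singleton] at hxC
    rcases hxC with (rfl | rfl) | (h | h)
    · rw [← h1, hskew.invol, h1, Lit.compl_compl]
    · exact hbar _ h2
    · rwa [← Lit.compl_compl x, h, Lit.compl_compl]
    · rwa [← h, Lit.compl_compl] at h2
  rw [← hτx, (hτ x hx).2]

lemma CNFIso.digraphIso {F F' : Finset (Finset Lit)} {f : Lit → Lit} (h : CNFIso F F' f) :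
    DigraphIso (idg F) (idg F') f := by
  obtain ⟨hbij, hcompl, hF'⟩ := h
  refine ⟨hbij, ?_⟩
  have himage : ∀ a ∈ litsOf F, ∀ b, (insert (Lit.compl a) {b} : Finset Lit).image f =
      insert (Lit.compl (f a)) {f b} := fun a ha b => by
    rw [Finset.image_insert, Finset.image_singleton, hcompl a ha]
  ext ⟨c, d⟩
  rw [mem_idg, Finset.mem_image]
  constructor
  · rintro ⟨⟨a, b⟩, hab, hcd⟩
    obtain ⟨rfl, rfl⟩ := Prod.mk.inj hcd
    rw [mem_idg] at hab
    rw [implies, ← himage a (implies_mem hab).1, ← hF']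
    exact Finset.mem_image_of_mem _ hab
  · intro hcd
    obtain ⟨a, ha, rfl⟩ := hbij.surjOn (Finset.mem_coe.2 (implies_mem hcd).1)
    obtain ⟨b, hb, rfl⟩ := hbij.surjOn (Finset.mem_coe.2 (implies_mem hcd).2)
    refine ⟨(a, b), ?_, rfl⟩
    have ha : a ∈ litsOf F := ha
    have hb : b ∈ litsOf F := hb
    rw [implies, ← himage a ha, ← hF'] at hcd
    obtain ⟨C, hC, hCf⟩ := Finset.mem_image.1 hcd
    have hsub : (insert (Lit.compl a) {b} : Finset Lit) ⊆ litsOf F := by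
      simp [Finset.insert_subset_iff, compl_mem ha, hb]
    have heq : (C : Set Lit) = ↑(insert (Lit.compl a) {b} : Finset Lit) := by
      refine (hbij.injOn.image_eq_image_iff (fun x hx => mem_litsOf hC hx)
        (Finset.coe_subset.2 hsub)).1 ?_
      rw [← Finset.coe_image, ← Finset.coe_image, hCf]
    rwa [mem_idg, implies, ← Finset.coe_injective heq]

theorem stmt0 (k : ℕ) (hk : 2 ≤ k) (F F' : Finset (Finset Lit)) (hF : MU2 F) (hF' : MU2 F')
    (hdF : deficiency F = (k : ℤ)) (hdF' : deficiency F' = (k : ℤ)) (f : Lit → Lit) :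
    CNFIso F F' f ↔ DigraphIso (idg F) (idg F') f := by
  have hd : 2 ≤ deficiency F := by omega
  have hd' : 2 ≤ deficiency F' := by omega
  refine ⟨CNFIso.digraphIso, fun hf => ?_⟩
  have hcompl : ∀ x ∈ litsOf F, f (Lit.compl x) = Lit.compl (f x) :=
    fun x hx => hf.map_compl hF hF' hd hd' hx
  have himage : ∀ a ∈ litsOf F, ∀ b, (insert (Lit.compl a) {b} : Finset Lit).image f =
      insert (Lit.compl (f a)) {f b} := fun a ha b => by
    rw [Finset.image_insert, Finset.image_singleton, hcompl a ha]
  refine ⟨hf.1, hcompl, ?_⟩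
  ext C
  rw [Finset.mem_image]
  constructor
  · rintro ⟨C, hC, rfl⟩
    obtain ⟨a, b, rfl⟩ := hF.eq_arc (hF.empty_notMem hd) hC
    obtain ⟨ha, hb⟩ := implies_mem hC
    rw [himage a ha]
    exact (hf.implies_iff ha hb).2 hC
  · intro hC
    obtain ⟨c, d, rfl⟩ := hF'.eq_arc (hF'.empty_notMem hd') hC
    obtain ⟨hc, hd⟩ := implies_mem hC
    obtain ⟨a, ha, rfl⟩ := hf.1.surjOn (Finset.mem_coe.2 hc)
    obtain ⟨b, hb, rfl⟩ := hf.1.surjOn (Finset.mem_coe.2 hd)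
    exact ⟨_, (hf.implies_iff ha hb).1 hC, himage a ha b⟩
end

section
/- Every weak double cycle has at most one unit-free skew-symmetry: if G is an m-WDC for some m ≥ 3 and σ, σ' are both unit-free skew-symmetries of G, then σ = σ'. -/
section Blowup

variable {γ δ ι : Type}

/-- `X` with the relation `N` arises from `C` with the relation `D` by replacing each `e ∈ C` by
a directed path with `L e + 1` elements: `x ∈ X` sits in the path replacing `h x` at
position `r x`. -/
structure Blowup (X : Set γ) (N : γ → γ → Prop) (C : Set ι) (D : ι → ι → Prop)
    (h : γ → ι) (r : γ → ℕ) (L : ι → ℕ) : Prop where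
  mem : ∀ x ∈ X, h x ∈ C
  le : ∀ x ∈ X, r x ≤ L (h x)
  inj : ∀ x ∈ X, ∀ y ∈ X, h x = h y → r x = r y → x = y
  surj : ∀ e ∈ C, ∀ j ≤ L e, ∃ x ∈ X, h x = e ∧ r x = j
  adj : ∀ x ∈ X, ∀ y ∈ X, (N x y ↔ (h x = h y ∧ r y = r x + 1) ∨
    (D (h x) (h y) ∧ r x = L (h x) ∧ r y = 0))

/-- Replacing a single element of a blow-up by a path with three elements gives a blow-up. -/
theorem Blowup.comp_single [DecidableEq γ] [DecidableEq ι]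
    {X : Set γ} {N : γ → γ → Prop} {Y : Set δ} {M : δ → δ → Prop}
    {C : Set ι} {D : ι → ι → Prop} {h : γ → ι} {r : γ → ℕ} {L : ι → ℕ}
    (H : Blowup X N C D h r L) {z : γ} (hz : z ∈ X) {k : δ → γ} {o : δ → ℕ}
    (K : Blowup Y M X N k o (fun x => if x = z then 2 else 0)) :
    Blowup Y M C D (h ∘ k)
      (fun a => r (k a) + (if h (k a) = h z ∧ r z < r (k a) then 2 else 0) + o a)
      (fun e => L e + if e = h z then 2 else 0) where
  mem a ha := H.mem _ (K.mem a ha)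
  le a ha := by
    have h1 := K.le a ha
    have h2 := H.le _ (K.mem a ha)
    simp only [Function.comp]
    grind
  inj a ha b hb hab hr := by
    have h1 := K.le a ha
    have h2 := K.le b hb
    have ea := H.inj _ (K.mem a ha) _ hz
    have eb := H.inj _ (K.mem b hb) _ hz
    have eab := H.inj _ (K.mem a ha) _ (K.mem b hb)
    have := K.inj a ha b hb
    simp only [Function.comp] at hab hr
    grind
  surj e he j hj := by
    simp only [Function.comp]
    by_cases hez : e = h z
    · subst hez
      simp only [if_true] at hj
      rcases lt_or_ge j (r z) with hlt | hge
      · obtain ⟨x, hx, hxe, hxj⟩ := H.surj _ he j (by have := H.le z hz; omega)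
        obtain ⟨a, ha, hax, hao⟩ := K.surj x hx 0 (Nat.zero_le _)
        exact ⟨a, ha, by grind⟩
      · rcases le_or_gt j (r z + 2) with hle | hgt
        · obtain ⟨a, ha, hax, hao⟩ := K.surj z hz (j - r z) (by simp; omega)
          exact ⟨a, ha, by grind⟩
        · obtain ⟨x, hx, hxe, hxj⟩ := H.surj _ he (j - 2) (by omega)
          obtain ⟨a, ha, hax, hao⟩ := K.surj x hx 0 (Nat.zero_le _)
          exact ⟨a, ha, by grind⟩
    · obtain ⟨x, hx, hxe, hxj⟩ := H.surj _ he j (by simpa [hez] using hj)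
      obtain ⟨a, ha, hax, hao⟩ := K.surj x hx 0 (Nat.zero_le _)
      exact ⟨a, ha, by grind⟩
  adj a ha b hb := by
    have h1 := K.le a ha
    have h2 := K.le b hb
    have h3 := H.le _ (K.mem a ha)
    have h4 := H.le _ (K.mem b hb)
    have hzL := H.le z hz
    have ea := H.inj _ (K.mem a ha) _ hz
    have eb := H.inj _ (K.mem b hb) _ hz
    have eab := H.inj _ (K.mem a ha) _ (K.mem b hb)
    rw [K.adj a ha b hb, H.adj _ (K.mem a ha) _ (K.mem b hb)]
    simp only [Function.comp] at *
    have last : (r (k a) + (if h (k a) = h z ∧ r z < r (k a) then 2 else 0) + o a =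
        L (h (k a)) + if h (k a) = h z then 2 else 0) ↔
        (r (k a) = L (h (k a)) ∧ o a = if k a = z then 2 else 0) := by grind
    have first : (r (k b) + (if h (k b) = h z ∧ r z < r (k b) then 2 else 0) + o b = 0) ↔
        (r (k b) = 0 ∧ o b = 0) := by grind
    have inner (hab : h (k a) = h (k b)) :
        (r (k b) + (if h (k b) = h z ∧ r z < r (k b) then 2 else 0) + o b =
          r (k a) + (if h (k a) = h z ∧ r z < r (k a) then 2 else 0) + o a + 1) ↔
        ((k a = k b ∧ o b = o a + 1) ∨
          (r (k b) = r (k a) + 1 ∧ (o a = if k a = z then 2 else 0) ∧ o b = 0)) := by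
      clear last first
      constructor
      · intro hh
        by_cases hkab : k a = k b
        · left; refine ⟨hkab, ?_⟩; rw [hkab] at hh; omega
        · right; grind
      · rintro (⟨h5, h6⟩ | ⟨h5, h6, h7⟩)
        · rw [h5]; omega
        · by_cases haz : k a = z <;> by_cases hbz : k b = z <;> grind
    rw [last, first]
    constructor
    · rintro (⟨h5, h6⟩ | ⟨⟨h5, h6⟩ | ⟨h5, h6, h7⟩, h8, h9⟩)
      · exact Or.inl ⟨by rw [h5], (inner (by rw [h5])).2 (Or.inl ⟨h5, h6⟩)⟩
      · exact Or.inl ⟨h5, (inner h5).2 (Or.inr ⟨h6, h8, h9⟩)⟩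
      · exact Or.inr ⟨h5, ⟨h6, h8⟩, h7, h9⟩
    · rintro (⟨h5, h6⟩ | ⟨h5, ⟨h6, h8⟩, h7, h9⟩)
      · rcases (inner h5).1 h6 with h7 | ⟨h7, h8, h9⟩
        · exact Or.inl h7
        · exact Or.inr ⟨Or.inl ⟨h5, h7⟩, h8, h9⟩
      · exact Or.inr ⟨Or.inr ⟨h5, h6, h7⟩, h8, h9⟩

/-- A fixed-point-free involution of `X` reversing the relation `N` and mapping no element to
one of its successors. -/
structure AntiInvolution (X : Set γ) (N : γ → γ → Prop) (S : γ → γ) : Prop where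
  mem : ∀ x ∈ X, S x ∈ X
  invol : ∀ x ∈ X, S (S x) = x
  rev : ∀ x ∈ X, ∀ y ∈ X, N x y → N (S y) (S x)
  ne : ∀ x ∈ X, S x ≠ x
  not_adj : ∀ x ∈ X, ¬ N x (S x)

/-- Every arc leaves an element with a second successor or enters one with a
second predecessor. -/
def Branching (C : Set ι) (D : ι → ι → Prop) : Prop :=
  ∀ e ∈ C, ∀ f ∈ C, D e f → (∃ f' ∈ C, f' ≠ f ∧ D e f') ∨ (∃ e' ∈ C, e' ≠ e ∧ D e' f)

variable {X : Set γ} {N : γ → γ → Prop} {C : Set ι} {D : ι → ι → Prop}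
  {h : γ → ι} {r : γ → ℕ} {L : ι → ℕ} {S S' : γ → γ}

theorem Blowup.inner_rev (H : Blowup X N C D h r L) (hD : Branching C D)
    (hS : AntiInvolution X N S) {x y : γ} (hx : x ∈ X) (hy : y ∈ X)
    (hxy : h x = h y) (hr : r y = r x + 1) :
    h (S x) = h (S y) ∧ r (S x) = r (S y) + 1 := by
  have hSx := hS.mem x hx
  have hSy := hS.mem y hy
  have hN : N (S y) (S x) := hS.rev x hx y hy ((H.adj x hx y hy).2 (Or.inl ⟨hxy, hr⟩))
  rcases (H.adj _ hSy _ hSx).1 hN with ⟨h1, h2⟩ | ⟨h1, h2, h3⟩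
  · exact ⟨h1.symm, h2⟩
  exfalso
  rcases hD _ (H.mem _ hSy) _ (H.mem _ hSx) h1 with ⟨f, hf, hne, hDf⟩ | ⟨f, hf, hne, hDf⟩
  · obtain ⟨w, hw, hwf, hwr⟩ := H.surj f hf 0 (Nat.zero_le _)
    subst hwf
    have hSw := hS.mem w hw
    have h4 := hS.rev _ hSy w hw ((H.adj _ hSy w hw).2 (Or.inr ⟨hDf, h2, hwr⟩))
    rw [hS.invol y hy] at h4
    rcases (H.adj _ hSw _ hy).1 h4 with ⟨h5, h6⟩ | ⟨h5, h6, h7⟩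
    · have : S w = x := H.inj _ hSw _ hx (h5.trans hxy.symm) (by omega)
      rw [← this, hS.invol w hw] at hne
      exact hne rfl
    · omega
  · obtain ⟨w, hw, hwf, hwr⟩ := H.surj f hf (L f) le_rfl
    subst hwf
    have hSw := hS.mem w hw
    have h4 := hS.rev w hw _ hSx ((H.adj w hw _ hSx).2 (Or.inr ⟨hDf, hwr, h3⟩))
    rw [hS.invol x hx] at h4
    rcases (H.adj _ hx _ hSw).1 h4 with ⟨h5, h6⟩ | ⟨h5, h6, h7⟩
    · have : S w = y := H.inj _ hSw _ hy (h5.symm.trans hxy) (by omega)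
      rw [← this, hS.invol w hw] at hne
      exact hne rfl
    · have := H.le y hy
      rw [← hxy] at this
      omega

theorem Blowup.path_rev (H : Blowup X N C D h r L) (hD : Branching C D)
    (hS : AntiInvolution X N S) {x y : γ} (hx : x ∈ X) (hy : y ∈ X) (hxy : h x = h y) :
    h (S x) = h (S y) ∧ r x + r (S x) = r y + r (S y) := by
  have key : ∀ n, ∀ x ∈ X, ∀ y ∈ X, h x = h y → r y = r x + n →
      h (S x) = h (S y) ∧ r x + r (S x) = r y + r (S y) := by
    intro n
    induction n with
    | zero =>
      intro x hx y hy hxy hr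
      rw [H.inj x hx y hy hxy (by omega)]
      exact ⟨rfl, rfl⟩
    | succ n ih =>
      intro x hx y hy hxy hr
      have hyL := H.le y hy
      obtain ⟨w, hw, hwe, hwr⟩ := H.surj (h y) (H.mem y hy) (r x + n) (by omega)
      obtain ⟨h1, h2⟩ := ih x hx w hw (hxy.trans hwe.symm) hwr
      obtain ⟨h3, h4⟩ := H.inner_rev hD hS hw hy hwe (by omega)
      exact ⟨h1.trans h3, by omega⟩
  rcases le_total (r x) (r y) with hle | hle
  · exact key (r y - r x) x hx y hy hxy (by omega)
  · obtain ⟨h1, h2⟩ := key (r x - r y) y hy x hx hxy.symm (by omega)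
    exact ⟨h1.symm, h2.symm⟩

theorem Blowup.rank_rev (H : Blowup X N C D h r L) (hD : Branching C D)
    (hS : AntiInvolution X N S) {x : γ} (hx : x ∈ X) : r x + r (S x) = L (h x) := by
  have hSx := hS.mem x hx
  obtain ⟨w, hw, hwe, hwr⟩ := H.surj (h (S x)) (H.mem _ hSx) 0 (Nat.zero_le _)
  obtain ⟨y, hy, hye, hyr⟩ := H.surj (h x) (H.mem x hx) (L (h x)) le_rfl
  have hSw := hS.mem w hw
  obtain ⟨h1, -⟩ := H.path_rev hD hS hw hSx hwe
  rw [hS.invol x hx] at h1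
  obtain ⟨-, h2⟩ := H.path_rev hD hS hSw hx h1
  obtain ⟨-, h3⟩ := H.path_rev hD hS hy hx hye
  rw [hS.invol w hw] at h2
  have := H.le _ hSw
  rw [h1] at this
  omega

theorem Blowup.path_ne (H : Blowup X N C D h r L) (hD : Branching C D)
    (hS : AntiInvolution X N S) {x : γ} (hx : x ∈ X) : h (S x) ≠ h x := by
  intro hxe
  obtain ⟨y, hy, hye, hyr⟩ := H.surj (h x) (H.mem x hx) (L (h x) / 2) (Nat.div_le_self _ _)
  have hSy := hS.mem y hy
  have h1 : h (S y) = h y := by rw [(H.path_rev hD hS hy hx hye).1, hxe, hye]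
  have h2 := H.rank_rev hD hS hy
  rw [hye] at h2
  rcases Nat.even_or_odd' (L (h x)) with ⟨c, hc | hc⟩
  · exact hS.ne y hy (H.inj _ hSy _ hy h1 (by omega))
  · exact hS.not_adj y hy ((H.adj y hy _ hSy).2 (Or.inl ⟨h1.symm, by omega⟩))

/-- A reversing involution of a blow-up descends to the set that was blown up. -/
theorem Blowup.exists_descent (H : Blowup X N C D h r L) (hD : Branching C D)
    (hS : AntiInvolution X N S) :
    ∃ T : ι → ι, (∀ x ∈ X, h (S x) = T (h x)) ∧ (∀ e ∈ C, T e ∈ C) ∧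
      (∀ e ∈ C, T (T e) = e) ∧ (∀ e ∈ C, T e ≠ e) ∧
      ∀ e ∈ C, ∀ f ∈ C, e ≠ f → D e f → D (T f) (T e) := by
  have hex : ∀ e, ∃ e', ∀ x ∈ X, h x = e → h (S x) = e' := by
    intro e
    by_cases hx : ∃ x ∈ X, h x = e
    · obtain ⟨x, hx, hxe⟩ := hx
      exact ⟨h (S x), fun y hy hye => (H.path_rev hD hS hy hx (hye.trans hxe.symm)).1⟩
    · exact ⟨e, fun x hxX hxe => absurd ⟨x, hxX, hxe⟩ hx⟩
  choose T hT using hex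
  have hT' : ∀ x ∈ X, h (S x) = T (h x) := fun x hx => hT _ x hx rfl
  have hlift : ∀ e ∈ C, ∃ x ∈ X, h x = e := fun e he => by
    obtain ⟨x, hx, hxe, -⟩ := H.surj e he 0 (Nat.zero_le _)
    exact ⟨x, hx, hxe⟩
  refine ⟨T, hT', ?_, ?_, ?_, ?_⟩
  · intro e he
    obtain ⟨x, hx, rfl⟩ := hlift e he
    exact hT' x hx ▸ H.mem _ (hS.mem x hx)
  · intro e he
    obtain ⟨x, hx, rfl⟩ := hlift e he
    rw [← hT' x hx, ← hT' _ (hS.mem x hx), hS.invol x hx]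
  · intro e he
    obtain ⟨x, hx, rfl⟩ := hlift e he
    exact hT' x hx ▸ H.path_ne hD hS hx
  · intro e he f hf hne hDef
    obtain ⟨x, hx, rfl, hxr⟩ := H.surj e he (L e) le_rfl
    obtain ⟨y, hy, rfl, hyr⟩ := H.surj f hf 0 (Nat.zero_le _)
    have hSx := hS.mem x hx
    have hSy := hS.mem y hy
    have h1 := hS.rev x hx y hy ((H.adj x hx y hy).2 (Or.inr ⟨hDef, hxr, hyr⟩))
    rw [← hT' x hx, ← hT' y hy]
    rcases (H.adj _ hSy _ hSx).1 h1 with ⟨h2, -⟩ | ⟨h2, -⟩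
    · have h3 := (H.path_rev hD hS hSy hSx h2).1
      rw [hS.invol x hx, hS.invol y hy] at h3
      exact absurd h3.symm hne
    · exact h2

theorem Blowup.eq_of_descent_eq (H : Blowup X N C D h r L) (hD : Branching C D)
    (hS : AntiInvolution X N S) (hS' : AntiInvolution X N S') {x : γ} (hx : x ∈ X)
    (hh : h (S x) = h (S' x)) : S x = S' x := by
  have h1 := H.rank_rev hD hS hx
  have h2 := H.rank_rev hD hS' hx
  exact H.inj _ (hS.mem x hx) _ (hS'.mem x hx) hh (by omega)

end Blowup

/-- Incidence between vertices and arcs: a vertex precedes the arcs leaving it, an arc precedes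
its head. -/
def eltAdj {β : Type} : β ⊕ β × β → β ⊕ β × β → Prop
  | .inl a, .inr p => p.1 = a
  | .inr p, .inl b => p.2 = b
  | _, _ => False

@[simp] theorem eltAdj_inl_inl {β : Type} (a b : β) : eltAdj (.inl a) (.inl b) ↔ False := Iff.rfl
@[simp] theorem eltAdj_inr_inr {β : Type} (p q : β × β) :
    eltAdj (.inr p) (.inr q) ↔ False := Iff.rfl
@[simp] theorem eltAdj_inl_inr {β : Type} (a : β) (p : β × β) :
    eltAdj (.inl a) (.inr p) ↔ p.1 = a := Iff.rfl
@[simp] theorem eltAdj_inr_inl {β : Type} (b : β) (p : β × β) :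
    eltAdj (.inr p) (.inl b) ↔ p.2 = b := Iff.rfl

/-- The vertices and arcs of a digraph. -/
def FinDigraph.elts {β : Type} (G : FinDigraph β) : Set (β ⊕ β × β) :=
  {x | Sum.elim (· ∈ G.V) (· ∈ G.E) x}

@[simp] theorem FinDigraph.inl_mem_elts {β : Type} (G : FinDigraph β) (a : β) :
    .inl a ∈ G.elts ↔ a ∈ G.V := Iff.rfl
@[simp] theorem FinDigraph.inr_mem_elts {β : Type} (G : FinDigraph β) (p : β × β) :
    .inr p ∈ G.elts ↔ p ∈ G.E := Iff.rfl

section Split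

variable {α : Type} [DecidableEq α] {G G' : FinDigraph α}

theorem SplitVertex.wellFormed (hG : G.WellFormed) (hs : SplitVertex G G') : G'.WellFormed := by
  obtain ⟨x, u, v, hx, hu, hv, huv, hV, hE⟩ := hs
  rintro ⟨a, b⟩ hp
  rw [hE] at hp
  rw [hV]
  simp only [Finset.mem_insert, Finset.mem_union, Finset.mem_filter, Finset.mem_image,
    Prod.exists, Prod.mk.injEq, Finset.mem_erase] at hp ⊢
  have hG' : ∀ a b, (a, b) ∈ G.E → a ∈ G.V ∧ b ∈ G.V ∧ a ≠ b := fun a b h => hG (a, b) h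
  grind

theorem SplitArc.wellFormed (hG : G.WellFormed) (hs : SplitArc G G') : G'.WellFormed := by
  obtain ⟨x, y, v, hxy, hv, hV, hE⟩ := hs
  rintro ⟨a, b⟩ hp
  rw [hE] at hp
  rw [hV]
  simp only [Finset.mem_insert, Prod.mk.injEq, Finset.mem_erase] at hp ⊢
  have hG' : ∀ a b, (a, b) ∈ G.E → a ∈ G.V ∧ b ∈ G.V ∧ a ≠ b := fun a b h => hG (a, b) h
  grind

/-- Splitting an arc replaces it by a path consisting of an arc, a vertex and an arc. -/
theorem SplitArc.blowup (hG : G.WellFormed) (hs : SplitArc G G') :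
    ∃ z ∈ G.elts, ∃ k o, Blowup G'.elts eltAdj G.elts eltAdj k o
      (fun x => if x = z then 2 else 0) := by
  obtain ⟨x, y, v, hxy, hv, hV, hE⟩ := hs
  have hG' : ∀ a b, (a, b) ∈ G.E → a ∈ G.V ∧ b ∈ G.V ∧ a ≠ b := fun a b h => hG (a, b) h
  have hVm : ∀ a, a ∈ G'.V ↔ a = v ∨ a ∈ G.V := by simp [hV]
  have hEm : ∀ a b, (a, b) ∈ G'.E ↔ (a = x ∧ b = v) ∨ (a = v ∧ b = y) ∨
      (¬ (a = x ∧ b = y) ∧ (a, b) ∈ G.E) := by simp [hE]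
  clear hV hE hG
  obtain ⟨hx, hy, hne⟩ := hG' x y hxy
  have hxv : x ≠ v := fun h => hv (h ▸ hx)
  have hyv : y ≠ v := fun h => hv (h ▸ hy)
  refine ⟨.inr (x, y), hxy,
    Sum.elim (fun w => if w = v then .inr (x, y) else .inl w)
      (fun p => if p.1 = v ∨ p.2 = v then .inr (x, y) else .inr p),
    Sum.elim (fun w => if w = v then 1 else 0) (fun p => if p.1 = v then 2 else 0),
    ?_, ?_, ?_, ?_, ?_⟩
  · rintro (w | ⟨a, b⟩) hw <;>
      simp only [FinDigraph.inl_mem_elts, FinDigraph.inr_mem_elts, hVm, hEm, Sum.elim_inl,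
        Sum.elim_inr] at hw ⊢ <;>
      split_ifs <;> simp <;> grind
  · rintro (w | ⟨a, b⟩) hw <;>
      simp only [FinDigraph.inl_mem_elts, FinDigraph.inr_mem_elts, hVm, hEm, Sum.elim_inl,
        Sum.elim_inr] at hw ⊢ <;>
      grind
  · rintro (w | ⟨a, b⟩) hw (w' | ⟨a', b'⟩) hw' <;>
      simp only [FinDigraph.inl_mem_elts, FinDigraph.inr_mem_elts, hVm, hEm, Sum.elim_inl,
        Sum.elim_inr] at hw hw' ⊢ <;>
      grind
  · rintro (w | ⟨a, b⟩) hw j hj <;>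
      simp only [FinDigraph.inl_mem_elts, FinDigraph.inr_mem_elts] at hw
    · refine ⟨.inl w, ?_⟩
      simp only [FinDigraph.inl_mem_elts, hVm, Sum.elim_inl]
      grind
    · by_cases hab : a = x ∧ b = y
      · obtain ⟨rfl, rfl⟩ := hab
        simp at hj
        interval_cases j
        · exact ⟨.inr (a, v), by simp [hEm], by simp, by simp [hxv]⟩
        · exact ⟨.inl v, by simp [hVm], by simp, by simp⟩
        · exact ⟨.inr (v, b), by simp [hEm], by simp, by simp⟩
      · refine ⟨.inr (a, b), ?_⟩
        simp only [FinDigraph.inr_mem_elts, hEm, Sum.elim_inr]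
        grind
  · rintro (w | ⟨a, b⟩) hw (w' | ⟨a', b'⟩) hw' <;>
      simp only [FinDigraph.inl_mem_elts, FinDigraph.inr_mem_elts, hVm, hEm, Sum.elim_inl,
        Sum.elim_inr] at hw hw' ⊢
    all_goals split_ifs <;> simp <;> grind

/-- Splitting a vertex replaces it by a path consisting of a vertex, an arc and a vertex. -/
theorem SplitVertex.blowup (hG : G.WellFormed) (hs : SplitVertex G G') :
    ∃ z ∈ G.elts, ∃ k o, Blowup G'.elts eltAdj G.elts eltAdj k o
      (fun x => if x = z then 2 else 0) := by
  obtain ⟨x, u, v, hx, hu, hv, huv, hV, hE⟩ := hs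
  have hG' : ∀ a b, (a, b) ∈ G.E → a ∈ G.V ∧ b ∈ G.V ∧ a ≠ b := fun a b h => hG (a, b) h
  have hVm : ∀ a, a ∈ G'.V ↔ a = u ∨ a = v ∨ a ≠ x ∧ a ∈ G.V := by simp [hV]
  have hEm : ∀ a b, (a, b) ∈ G'.E ↔ (a = u ∧ b = v) ∨ ((a, b) ∈ G.E ∧ a ≠ x ∧ b ≠ x) ∨
      ((a, x) ∈ G.E ∧ b = u) ∨ ((x, b) ∈ G.E ∧ a = v) := by
    intro a b
    simp only [hE, Finset.mem_insert, Finset.mem_union, Finset.mem_filter, Finset.mem_image,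
      Prod.exists, Prod.mk.injEq]
    grind
  clear hV hE hG
  have hxu : x ≠ u := fun h => hu (h ▸ hx)
  have hxv : x ≠ v := fun h => hv (h ▸ hx)
  refine ⟨.inl x, hx,
    Sum.elim (fun w => if w = u ∨ w = v then .inl x else .inl w)
      (fun p => if p.1 = u then .inl x else
        .inr (if p.1 = v then x else p.1, if p.2 = u then x else p.2)),
    Sum.elim (fun w => if w = v then 2 else 0) (fun p => if p.1 = u then 1 else 0),
    ?_, ?_, ?_, ?_, ?_⟩
  · rintro (w | ⟨a, b⟩) hw <;>
      simp only [FinDigraph.inl_mem_elts, FinDigraph.inr_mem_elts, hVm, hEm, Sum.elim_inl,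
        Sum.elim_inr] at hw ⊢ <;>
      split_ifs <;> simp <;> grind
  · rintro (w | ⟨a, b⟩) hw <;>
      simp only [FinDigraph.inl_mem_elts, FinDigraph.inr_mem_elts, hVm, hEm, Sum.elim_inl,
        Sum.elim_inr] at hw ⊢ <;>
      grind
  · rintro (w | ⟨a, b⟩) hw (w' | ⟨a', b'⟩) hw' <;>
      simp only [FinDigraph.inl_mem_elts, FinDigraph.inr_mem_elts, hVm, hEm, Sum.elim_inl,
        Sum.elim_inr] at hw hw' ⊢ <;>
      grind
  · rintro (w | ⟨a, b⟩) hw j hj <;>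
      simp only [FinDigraph.inl_mem_elts, FinDigraph.inr_mem_elts] at hw
    · by_cases hwx : w = x
      · subst hwx
        simp at hj
        interval_cases j
        · exact ⟨.inl u, by simp [hVm], by simp, by simp [huv]⟩
        · exact ⟨.inr (u, v), by simp [hEm], by simp, by simp⟩
        · exact ⟨.inl v, by simp [hVm], by simp, by simp⟩
      · refine ⟨.inl w, ?_⟩
        simp only [FinDigraph.inl_mem_elts, hVm, Sum.elim_inl]
        grind
    · refine ⟨.inr (if a = x then v else a, if b = x then u else b), ?_⟩
      simp only [FinDigraph.inr_mem_elts, hEm, Sum.elim_inr]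
      grind
  · rintro (w | ⟨a, b⟩) hw (w' | ⟨a', b'⟩) hw' <;>
      simp only [FinDigraph.inl_mem_elts, FinDigraph.inr_mem_elts, hVm, hEm, Sum.elim_inl,
        Sum.elim_inr] at hw hw' ⊢
    all_goals split_ifs <;> simp <;> grind

end Split

section Cycle

/-- The vertices and arcs of the double cycle on `ZMod m`. -/
def cycleElts (m : ℕ) : Set (ZMod m ⊕ ZMod m × ZMod m) :=
  {x | Sum.elim (fun _ => True) (fun p => p.2 = p.1 + 1 ∨ p.1 = p.2 + 1) x}

@[simp] theorem inl_mem_cycleElts {m : ℕ} (a : ZMod m) : .inl a ∈ cycleElts m := trivial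
@[simp] theorem inr_mem_cycleElts {m : ℕ} (p : ZMod m × ZMod m) :
    .inr p ∈ cycleElts m ↔ p.2 = p.1 + 1 ∨ p.1 = p.2 + 1 := Iff.rfl

theorem ZMod.natCast_ne_zero_of_lt {m k : ℕ} (hk : 0 < k) (hkm : k < m) : (k : ZMod m) ≠ 0 := by
  rw [Ne, ZMod.natCast_eq_zero_iff]
  exact fun h => absurd (Nat.le_of_dvd hk h) (by omega)

theorem ZMod.add_one_ne_sub_one {m : ℕ} (hm : 3 ≤ m) (a : ZMod m) : a + 1 ≠ a - 1 := by
  intro h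
  apply ZMod.natCast_ne_zero_of_lt (m := m) (k := 2) (by omega) (by omega)
  push_cast
  linear_combination h

theorem branching_cycleElts {m : ℕ} (hm : 3 ≤ m) : Branching (cycleElts m) eltAdj := by
  have key := ZMod.add_one_ne_sub_one hm
  have key' : ∀ a b : ZMod m, a = b + 1 → a ≠ b - 1 := fun a b h h' => key b (h.symm.trans h')
  rintro (a | ⟨a, b⟩) he (c | ⟨c, d⟩) hf h
  · exact h.elim
  · left
    obtain rfl : c = a := h
    rcases hf with hf | hf
    · exact ⟨.inr (c, c - 1), Or.inr (sub_add_cancel c 1).symm,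
        fun h => key' d c hf (Prod.mk.inj (Sum.inr.inj h)).2.symm, rfl⟩
    · exact ⟨.inr (c, c + 1), Or.inl rfl,
        fun h => key' (c + 1) c rfl ((Prod.mk.inj (Sum.inr.inj h)).2.trans
          (eq_sub_of_add_eq hf.symm)), rfl⟩
  · right
    obtain rfl : b = c := h
    rcases he with he | he
    · exact ⟨.inr (b + 1, b), Or.inr rfl,
        fun h => key' (b + 1) b rfl ((Prod.mk.inj (Sum.inr.inj h)).1.trans
          (eq_sub_of_add_eq he.symm)), rfl⟩
    · exact ⟨.inr (b - 1, b), Or.inl (sub_add_cancel b 1).symm,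
        fun h => key' a b he (Prod.mk.inj (Sum.inr.inj h)).1.symm, rfl⟩
  · exact h.elim

theorem ZMod.eq_of_add_self_eq_zero {m : ℕ} [NeZero m] {a b : ZMod m} (ha : a ≠ 0) (hb : b ≠ 0)
    (haa : a + a = 0) (hbb : b + b = 0) : a = b := by
  have key : ∀ c : ZMod m, c ≠ 0 → c + c = 0 → c.val + c.val = m := by
    intro c hc hcc
    have h1 : ((c.val + c.val : ℕ) : ZMod m) = 0 := by
      push_cast
      rw [ZMod.natCast_zmod_val, hcc]
    obtain ⟨q, hq⟩ := (ZMod.natCast_eq_zero_iff _ _).1 h1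
    have h2 := ZMod.val_lt c
    have h3 : c.val ≠ 0 := by rwa [Ne, ZMod.val_eq_zero]
    have : q = 1 := by
      rcases q with _ | _ | q
      · omega
      · rfl
      · nlinarith
    rw [hq, this, mul_one]
  apply ZMod.val_injective
  have := key a ha haa
  have := key b hb hbb
  omega

/-- An adjacency-preserving involution of a cycle which fixes no vertex and no edge is the
half turn. -/
theorem ZMod.exists_eq_add_of_involutive {m : ℕ} (hm : 3 ≤ m) {ρ : ZMod m → ZMod m}
    (hinv : ∀ i, ρ (ρ i) = i) (hne : ∀ i, ρ i ≠ i) (hne' : ∀ i, ρ i ≠ i + 1)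
    (hadj : ∀ i, ρ (i + 1) = ρ i + 1 ∨ ρ i = ρ (i + 1) + 1) :
    ∃ a, a ≠ 0 ∧ a + a = 0 ∧ ∀ i, ρ i = i + a := by
  have : NeZero m := ⟨by omega⟩
  have inj : Function.Injective ρ := fun i j h => by rw [← hinv i, h, hinv j]
  have two : ∀ i : ZMod m, i + 1 + 1 ≠ i := fun i h =>
    ZMod.add_one_ne_sub_one hm i (by linear_combination h)
  rcases hadj 0 with h0 | h0
  · have step : ∀ n : ℕ, ρ ((n : ZMod m) + 1) = ρ n + 1 := by
      intro n
      induction n with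
      | zero => simpa using h0
      | succ n ih =>
        push_cast
        rcases hadj ((n : ZMod m) + 1) with h | h
        · exact h
        · refine absurd (inj ?_) (two n)
          linear_combination ih - h
    have all : ∀ n : ℕ, ρ n = n + ρ 0 := by
      intro n
      induction n with
      | zero => simp
      | succ n ih =>
        push_cast
        rw [step, ih]
        ring
    have all' : ∀ i, ρ i = i + ρ 0 := fun i => by
      simpa using all i.val
    refine ⟨ρ 0, hne 0, ?_, all'⟩
    have := all' (ρ 0)
    rw [hinv] at this
    exact this.symm
  · exfalso
    have step : ∀ n : ℕ, ρ n = ρ ((n : ZMod m) + 1) + 1 := by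
      intro n
      induction n with
      | zero => simpa using h0
      | succ n ih =>
        push_cast
        rcases hadj ((n : ZMod m) + 1) with h | h
        · refine absurd (inj ?_) (two n)
          linear_combination h - ih
        · exact h
    have all : ∀ n : ℕ, ρ n = ρ 0 - n := by
      intro n
      induction n with
      | zero => simp
      | succ n ih =>
        push_cast
        have := step n
        linear_combination ih - this
    have hval : ((ρ 0).val : ZMod m) = ρ 0 := ZMod.natCast_zmod_val _
    rcases Nat.even_or_odd' (ρ 0).val with ⟨c, hc | hc⟩
    · rw [hc] at hval
      push_cast at hval
      apply hne c
      rw [all, ← hval]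
      ring
    · rw [hc] at hval
      push_cast at hval
      apply hne' c
      rw [all, ← hval]
      ring

/-- An arc-reversing involution of the vertices and arcs of a double cycle without fixed
elements comes from the half turn. -/
theorem exists_half_turn {m : ℕ} (hm : 3 ≤ m)
    {T : ZMod m ⊕ ZMod m × ZMod m → ZMod m ⊕ ZMod m × ZMod m}
    (hmem : ∀ e ∈ cycleElts m, T e ∈ cycleElts m) (hinv : ∀ e ∈ cycleElts m, T (T e) = e)
    (hne : ∀ e ∈ cycleElts m, T e ≠ e)
    (hrev : ∀ e ∈ cycleElts m, ∀ f ∈ cycleElts m, e ≠ f → eltAdj e f → eltAdj (T f) (T e)) :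
    ∃ a, a ≠ 0 ∧ a + a = 0 ∧ (∀ i, T (.inl i) = .inl (i + a)) ∧
      ∀ i j, .inr (i, j) ∈ cycleElts m → T (.inr (i, j)) = .inr (j + a, i + a) := by
  have hvert : ∀ i, ∃ j, T (.inl i) = .inl j := by
    intro i
    rcases hT : T (.inl i) with j | ⟨p, q⟩
    · exact ⟨j, rfl⟩
    have hp : (Sum.inr (i, i + 1) : ZMod m ⊕ ZMod m × ZMod m) ∈ cycleElts m := by simp
    have hn : (Sum.inr (i, i - 1) : ZMod m ⊕ ZMod m × ZMod m) ∈ cycleElts m := by simp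
    have key : ∀ e ∈ cycleElts m, eltAdj (.inl i) e → T e = .inl p := by
      intro e he hie
      have h1 := hrev _ (inl_mem_cycleElts i) e he (by rintro rfl; exact hie) hie
      rw [hT] at h1
      rcases hTe : T e with w | w
      · rw [hTe, eltAdj_inl_inr] at h1
        exact congrArg _ h1.symm
      · rw [hTe] at h1
        exact h1.elim
    have h2 := (key _ hp rfl).trans (key _ hn rfl).symm
    have h3 := congrArg T h2
    rw [hinv _ hp, hinv _ hn] at h3
    simp only [Sum.inr.injEq, Prod.mk.injEq, true_and] at h3
    exact absurd h3 (ZMod.add_one_ne_sub_one hm i)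
  choose ρ hρ using hvert
  have harc : ∀ i j, .inr (i, j) ∈ cycleElts m → T (.inr (i, j)) = .inr (ρ j, ρ i) := by
    intro i j hij
    have h1 := hrev _ (inl_mem_cycleElts i) _ hij (by simp) rfl
    have h2 := hrev _ hij _ (inl_mem_cycleElts j) (by simp) rfl
    rw [hρ] at h1 h2
    rcases hT : T (.inr (i, j)) with w | ⟨p, q⟩
    · rw [hT] at h1
      exact h1.elim
    · rw [hT] at h1 h2
      simp only [eltAdj_inr_inl, eltAdj_inl_inr] at h1 h2
      rw [h1, h2]
  have hρinv : ∀ i, ρ (ρ i) = i := by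
    intro i
    have := hinv _ (inl_mem_cycleElts i)
    rwa [hρ, hρ, Sum.inl.injEq] at this
  obtain ⟨a, ha, haa, hρa⟩ := ZMod.exists_eq_add_of_involutive hm hρinv
    (fun i h => hne _ (inl_mem_cycleElts i) (by rw [hρ, h]))
    (fun i h => hne (.inr (i, i + 1)) (by simp) (by
      rw [harc _ _ (by simp), ← h, hρinv]))
    (fun i => by
      have := hmem (.inr (i, i + 1)) (by simp)
      rw [harc _ _ (by simp), inr_mem_cycleElts] at this
      exact this.symm)
  exact ⟨a, ha, haa, fun i => by rw [hρ, hρa], fun i j hij => by rw [harc i j hij, hρa, hρa]⟩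

end Cycle

section WeakDoubleCycle

variable {α : Type} [DecidableEq α] {m : ℕ} {G : FinDigraph α}

theorem IsDoubleCycle.exists_zmod (hG : IsDoubleCycle m G) :
    ∃ g : α → ZMod m, Set.BijOn g ↑G.V Set.univ ∧
      ∀ a b, (a, b) ∈ G.E ↔ a ∈ G.V ∧ b ∈ G.V ∧ (g b = g a + 1 ∨ g a = g b + 1) := by
  obtain ⟨hm, f, hf, hE⟩ := hG
  have : NeZero m := ⟨by omega⟩
  have hg : Set.InvOn (Function.invFunOn f ↑(stdDoubleCycle m).V) f ↑(stdDoubleCycle m).V ↑G.V :=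
    hf.invOn_invFunOn
  have hg' : Set.BijOn (Function.invFunOn f ↑(stdDoubleCycle m).V) ↑G.V ↑(stdDoubleCycle m).V :=
    hf.symm hg.symm
  generalize Function.invFunOn f ↑(stdDoubleCycle m).V = g at hg hg'
  have hVm : ∀ i, i ∈ (stdDoubleCycle m).V ↔ i < m := by simp [stdDoubleCycle]
  have hcast : Set.BijOn (Nat.cast : ℕ → ZMod m) ↑(stdDoubleCycle m).V Set.univ := by
    refine ⟨fun _ _ => trivial, ?_, ?_⟩
    · intro i hi j hj hij
      rw [Finset.mem_coe, hVm] at hi hj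
      have := congrArg ZMod.val hij
      simpa [ZMod.val_natCast, Nat.mod_eq_of_lt hi, Nat.mod_eq_of_lt hj] using this
    · intro i _
      exact ⟨i.val, by rw [Finset.mem_coe, hVm]; exact ZMod.val_lt i, ZMod.natCast_zmod_val i⟩
  have hEm : ∀ i j, (i, j) ∈ (stdDoubleCycle m).E ↔
      i < m ∧ j < m ∧ ((j : ZMod m) = i + 1 ∨ (i : ZMod m) = j + 1) := by
    have succ_iff : ∀ i j, j < m → (j = (i + 1) % m ↔ (j : ZMod m) = i + 1) := by
      intro i j hj
      rw [← Nat.cast_succ, ZMod.natCast_eq_natCast_iff', Nat.mod_eq_of_lt hj]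
    intro i j
    simp only [stdDoubleCycle, Finset.mem_biUnion, Finset.mem_range, Finset.mem_insert,
      Finset.mem_singleton, Prod.mk.injEq]
    constructor
    · rintro ⟨k, hk, ⟨rfl, hj⟩ | ⟨hi, rfl⟩⟩
      · have hjm : j < m := hj ▸ Nat.mod_lt _ (by omega)
        exact ⟨hk, hjm, Or.inl ((succ_iff _ _ hjm).1 hj)⟩
      · have him : i < m := hi ▸ Nat.mod_lt _ (by omega)
        exact ⟨him, hk, Or.inr ((succ_iff _ _ him).1 hi)⟩
    · rintro ⟨hi, hj, h | h⟩
      · exact ⟨i, hi, Or.inl ⟨rfl, (succ_iff _ _ hj).2 h⟩⟩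
      · exact ⟨j, hj, Or.inr ⟨(succ_iff _ _ hi).2 h, rfl⟩⟩
  refine ⟨fun v => (g v : ZMod m), hcast.comp hg', fun a b => ?_⟩
  rw [← hE, Finset.mem_image]
  constructor
  · rintro ⟨⟨i, j⟩, hij, h⟩
    obtain ⟨rfl, rfl⟩ := Prod.mk.inj h
    obtain ⟨hi, hj, hadj⟩ := (hEm i j).1 hij
    have hi' := (hVm i).2 hi
    have hj' := (hVm j).2 hj
    refine ⟨hf.mapsTo hi', hf.mapsTo hj', ?_⟩
    simp only [hg.1 hi', hg.1 hj']
    exact hadj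
  · rintro ⟨ha, hb, hadj⟩
    exact ⟨(g a, g b), (hEm _ _).2 ⟨(hVm _).1 (hg'.mapsTo ha), (hVm _).1 (hg'.mapsTo hb), hadj⟩,
      Prod.ext (hg.2 ha) (hg.2 hb)⟩

theorem IsDoubleCycle.wellFormed (hG : IsDoubleCycle m G) : G.WellFormed := by
  obtain ⟨g, -, hE⟩ := hG.exists_zmod
  rintro ⟨a, b⟩ hab
  obtain ⟨ha, hb, h⟩ := (hE a b).1 hab
  refine ⟨ha, hb, ?_⟩
  have h1 := ZMod.natCast_ne_zero_of_lt (m := m) (k := 1) (by omega) (by have := hG.1; omega)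
  intro hab'
  obtain rfl : a = b := hab'
  simp_all

theorem IsDoubleCycle.blowup (hG : IsDoubleCycle m G) :
    ∃ h, Blowup G.elts eltAdj (cycleElts m) eltAdj h (fun _ => 0) (fun _ => 0) := by
  obtain ⟨g, hg, hE⟩ := hG.exists_zmod
  have hinj : ∀ a ∈ G.V, ∀ b ∈ G.V, g a = g b → a = b := fun a ha b hb h => hg.injOn ha hb h
  have hsurj : ∀ i, ∃ a ∈ G.V, g a = i := fun i => hg.surjOn (Set.mem_univ i)
  refine ⟨Sum.map g (Prod.map g g), ?_, fun _ _ => le_rfl, ?_, ?_, ?_⟩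
  · rintro (a | ⟨a, b⟩) hx
    · simp
    · exact ((hE a b).1 hx).2.2
  · rintro (a | ⟨a, b⟩) hx (c | ⟨c, d⟩) hy hxy - <;> simp at hx hy hxy
    · rw [hinj a hx c hy hxy]
    · obtain ⟨ha, hb, -⟩ := (hE a b).1 hx
      obtain ⟨hc, hd, -⟩ := (hE c d).1 hy
      rw [hinj a ha c hc hxy.1, hinj b hb d hd hxy.2]
  · rintro (i | ⟨i, j⟩) he k hk
    · obtain ⟨a, ha, rfl⟩ := hsurj i
      exact ⟨.inl a, ha, rfl, (Nat.le_zero.1 hk).symm⟩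
    · obtain ⟨a, ha, rfl⟩ := hsurj i
      obtain ⟨b, hb, rfl⟩ := hsurj j
      exact ⟨.inr (a, b), (hE a b).2 ⟨ha, hb, he⟩, rfl, (Nat.le_zero.1 hk).symm⟩
  · rintro (a | ⟨a, b⟩) hx (c | ⟨c, d⟩) hy <;> simp at hx hy ⊢
    · exact ⟨fun h => by rw [h], hinj c ((hE c d).1 hy).1 a hx⟩
    · exact ⟨fun h => by rw [h], hinj b ((hE a b).1 hx).2.1 c hy⟩

theorem IsWDC.blowup (hG : IsWDC m G) :
    ∃ h r L, Blowup G.elts eltAdj (cycleElts m) eltAdj h r L := by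
  obtain ⟨G₀, h₀, hsplit⟩ := hG
  have key : G.WellFormed ∧ ∃ h r L, Blowup G.elts eltAdj (cycleElts m) eltAdj h r L := by
    induction hsplit with
    | refl =>
      obtain ⟨h, H⟩ := h₀.blowup
      exact ⟨h₀.wellFormed, h, _, _, H⟩
    | tail _ hstep ih =>
      obtain ⟨hwf, h, r, L, H⟩ := ih
      rcases hstep with hs | hs
      · obtain ⟨z, hz, k, o, K⟩ := hs.blowup hwf
        exact ⟨hs.wellFormed hwf, _, _, _, H.comp_single hz K⟩
      · obtain ⟨z, hz, k, o, K⟩ := hs.blowup hwf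
        exact ⟨hs.wellFormed hwf, _, _, _, H.comp_single hz K⟩
  exact key.2

theorem IsWDC.wellFormed (hG : IsWDC m G) : G.WellFormed := by
  obtain ⟨G₀, h₀, hsplit⟩ := hG
  induction hsplit with
  | refl => exact h₀.wellFormed
  | tail _ hstep ih => exact hstep.elim (fun hs => hs.wellFormed ih) (fun hs => hs.wellFormed ih)

/-- The map on vertices and arcs induced by a permutation of the vertices, reversing arcs. -/
def reverseElt (G : FinDigraph α) (σ : Equiv.Perm {x // x ∈ G.V}) : α ⊕ α × α → α ⊕ α × α :=
  Sum.map (Equiv.Perm.ofSubtype σ) (fun p => (Equiv.Perm.ofSubtype σ p.2,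
    Equiv.Perm.ofSubtype σ p.1))

theorem IsSkewSym.antiInvolution (hG : G.WellFormed) {σ : Equiv.Perm {x // x ∈ G.V}}
    (hσ : IsSkewSym G σ) (hu : ¬ HasUnit G σ) :
    AntiInvolution G.elts eltAdj (reverseElt G σ) := by
  obtain ⟨hinv, hne, hrev⟩ := hσ
  have hof : ∀ a (ha : a ∈ G.V), Equiv.Perm.ofSubtype σ a = σ ⟨a, ha⟩ := fun a ha =>
    Equiv.Perm.ofSubtype_apply_of_mem σ ha
  have hmem : ∀ a ∈ G.V, Equiv.Perm.ofSubtype σ a ∈ G.V := fun a ha => by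
    rw [hof a ha]
    exact (σ ⟨a, ha⟩).2
  have hinv' : ∀ a ∈ G.V, Equiv.Perm.ofSubtype σ (Equiv.Perm.ofSubtype σ a) = a := fun a ha => by
    rw [hof a ha, Equiv.Perm.ofSubtype_apply_coe, hinv]
  constructor
  · rintro (a | ⟨a, b⟩) hx
    · exact hmem a hx
    · obtain ⟨ha, hb, -⟩ := hG _ hx
      simp only [reverseElt, Sum.map_inr, FinDigraph.inr_mem_elts]
      rw [hof a ha, hof b hb]
      exact hrev ⟨a, ha⟩ ⟨b, hb⟩ hx
  · rintro (a | ⟨a, b⟩) hx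
    · simp [reverseElt, hinv' a hx]
    · obtain ⟨ha, hb, -⟩ := hG _ hx
      simp [reverseElt, hinv' a ha, hinv' b hb]
  · rintro (a | ⟨a, b⟩) hx (c | ⟨c, d⟩) hy h
    · exact h.elim
    · rw [eltAdj_inl_inr] at h
      simp [reverseElt, ← h]
    · rw [eltAdj_inr_inl] at h
      simp [reverseElt, ← h]
    · exact h.elim
  · rintro (a | ⟨a, b⟩) hx h
    · simp only [reverseElt, Sum.map_inl, Sum.inl.injEq] at h
      rw [hof a hx] at h
      exact hne ⟨a, hx⟩ (Subtype.ext h)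
    · obtain ⟨ha, hb, -⟩ := hG _ hx
      simp only [reverseElt, Sum.map_inr, Sum.inr.injEq, Prod.mk.injEq] at h
      refine hu ⟨⟨a, ha⟩, ?_⟩
      rw [← hof a ha, h.2]
      exact hx
  · rintro (a | ⟨a, b⟩) hx h <;> exact h.elim

end WeakDoubleCycle

theorem stmt2 (m : ℕ) (G : FinDigraph ℕ) (hm : 3 ≤ m) (hG : IsWDC m G)
    (σ σ' : Equiv.Perm {x // x ∈ G.V})
    (hσ : IsSkewSym G σ) (hσu : ¬ HasUnit G σ)
    (hσ' : IsSkewSym G σ') (hσ'u : ¬ HasUnit G σ') : σ = σ' := by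
  obtain ⟨h, r, L, H⟩ := hG.blowup
  have : NeZero m := ⟨by omega⟩
  have hD := branching_cycleElts hm
  have hS := hσ.antiInvolution hG.wellFormed hσu
  have hS' := hσ'.antiInvolution hG.wellFormed hσ'u
  obtain ⟨T, hT, hmem, hinv, hne, hrev⟩ := H.exists_descent hD hS
  obtain ⟨T', hT', hmem', hinv', hne', hrev'⟩ := H.exists_descent hD hS'
  obtain ⟨a, ha, haa, hv, he⟩ := exists_half_turn hm hmem hinv hne hrev
  obtain ⟨a', ha', haa', hv', he'⟩ := exists_half_turn hm hmem' hinv' hne' hrev'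
  obtain rfl := ZMod.eq_of_add_self_eq_zero ha ha' haa haa'
  have hTT : ∀ e ∈ cycleElts m, T e = T' e := by
    rintro (i | ⟨i, j⟩) hmem
    · rw [hv, hv']
    · rw [he i j hmem, he' i j hmem]
  ext ⟨x, hx⟩
  have hx' : (Sum.inl x : ℕ ⊕ ℕ × ℕ) ∈ G.elts := hx
  have key := H.eq_of_descent_eq hD hS hS' hx' (by
    rw [hT _ hx', hT' _ hx', hTT _ (H.mem _ hx')])
  simpa [reverseElt, Equiv.Perm.ofSubtype_apply_of_mem _ hx] using key
end
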